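/- Let f₂ = yz − x² and f₃ = 40y³ + 21xyz − 21x³ in ℂ[x,y,z], and consider the pencil F = [f₂³ : f₃²] on ℙ². Then there exists a finite set A ⊆ ℙ¹ containing [0:1] and [1:0] such that for every r ≥ 0 and every choice of r+1 distinct points [a₀:b₀], …, [a_r:b_r] ∈ ℙ¹ \ A, setting C_B = ⋃_{i=0}^{r} V(b_i·f₂³ − a_i·f₃²), one has both π₁(ℙ² \ (C_B ∪ V(f₃))) ≅ 𝔽_{r+1} * ℤ₃ and π₁(ℙ² \ (C_B ∪ V(f₂))) ≅ 𝔽_{r+1} * ℤ₂. -/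

import Mathlib

open MvPolynomial

noncomputable section

/-- The complex projective plane, as the projectivization of `ℂ³`. -/
abbrev P2 : Type := Projectivization ℂ (Fin 3 → ℂ)

/-- The complex projective line, as the projectivization of `ℂ²`. -/
abbrev P1 : Type := Projectivization ℂ (Fin 2 → ℂ)

instance : TopologicalSpace P2 :=
  inferInstanceAs (TopologicalSpace (Quotient (projectivizationSetoid ℂ (Fin 3 → ℂ))))

instance : TopologicalSpace P1 :=
  inferInstanceAs (TopologicalSpace (Quotient (projectivizationSetoid ℂ (Fin 2 → ℂ))))

/-- The zero locus in `ℙ²` of a homogeneous polynomial `g ∈ ℂ[x,y,z]`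
(for homogeneous `g` the vanishing of `g` at the chosen representative `x.rep`
is independent of the choice of representative). -/
def V (g : MvPolynomial (Fin 3) ℂ) : Set P2 :=
  {x | eval x.rep g = 0}

/-- The point `[a:b] ∈ ℙ¹`. -/
def pt (a b : ℂ) (hab : ![a, b] ≠ 0) : P1 := Projectivization.mk ℂ ![a, b] hab

section
open Set Topology Filter unitInterval

namespace FGP

/-- Induction principle for path classes subordinate to an open cover. -/
theorem gen {X ι : Type*} [TopologicalSpace X] (U : ι → Set X) (hU : ∀ j, IsOpen (U j))
    (P : ∀ x y : X, Path.Homotopic.Quotient x y → Prop)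
    (hloc : ∀ j x y (γ : Path x y), (∀ t, γ t ∈ U j) → P x y (.mk γ))
    (htr : ∀ x y z (a : Path.Homotopic.Quotient x y) (b : Path.Homotopic.Quotient y z),
      P x y a → P y z b → P x z (a.trans b)) :
    ∀ x y (γ : Path x y), (∀ t, ∃ j, γ t ∈ U j) → P x y (.mk γ) := by
  intro x y γ hcov
  obtain ⟨t, ht0, htm, ⟨n, hn⟩, ht⟩ := exists_monotone_Icc_subset_open_cover_unitInterval
    (c := fun j => γ ⁻¹' U j) (fun j => (hU j).preimage γ.continuous)
    (fun s _ => mem_iUnion.2 (hcov s))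
  have key : ∀ m, P (γ (t 0)) (γ (t m)) (.mk (γ.subpath (t 0) (t m))) := by
    intro m
    induction m with
    | zero =>
      obtain ⟨j, hj⟩ := hcov (t 0)
      apply hloc j
      intro s
      rw [Path.subpath_self]
      simpa using hj
    | succ m ih =>
      have h1 : (Path.Homotopic.Quotient.mk (γ.subpath (t 0) (t (m+1)))) =
          (Path.Homotopic.Quotient.mk (γ.subpath (t 0) (t m))).trans
            (.mk (γ.subpath (t m) (t (m+1)))) := by
        rw [← Path.Homotopic.Quotient.mk_trans]
        exact (Path.Homotopic.Quotient.eq.2 ⟨Path.Homotopy.subpathTransSubpath γ _ _ _⟩).symm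
      rw [h1]
      refine htr _ _ _ _ _ ih ?_
      obtain ⟨j, hj⟩ := ht m
      apply hloc j
      intro s
      have : (γ.subpath (t m) (t (m+1))) s ∈ range (γ.subpath (t m) (t (m+1))) := ⟨s, rfl⟩
      rw [Path.range_subpath_of_le _ _ _ (htm (Nat.le_succ m))] at this
      obtain ⟨s', hs', h⟩ := this
      rw [← h]; exact hj hs'
  have h2 := key n
  have hgen : ∀ s0 s1 : I, s0 = 0 → s1 = 1 → P (γ s0) (γ s1) (.mk (γ.subpath s0 s1)) →
      P x y (.mk γ) := by
    rintro s0 s1 rfl rfl h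
    rw [Path.subpath_zero_one] at h
    have : ∀ (x' y' : X) (hx : x' = x) (hy : y' = y), P x' y' (.mk (γ.cast hx hy)) →
        P x y (.mk γ) := by
      rintro _ _ rfl rfl h; exact h
    exact this _ _ _ _ h
  exact hgen _ _ ht0 (hn n le_rfl) h2

theorem gen_all {X ι : Type*} [TopologicalSpace X] (U : ι → Set X) (hU : ∀ j, IsOpen (U j))
    (hcov : ∀ x, ∃ j, x ∈ U j)
    (P : ∀ x y : X, Path.Homotopic.Quotient x y → Prop)
    (hloc : ∀ j x y (γ : Path x y), (∀ t, γ t ∈ U j) → P x y (.mk γ))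
    (htr : ∀ x y z (a : Path.Homotopic.Quotient x y) (b : Path.Homotopic.Quotient y z),
      P x y a → P y z b → P x z (a.trans b)) :
    ∀ x y q, P x y q := by
  intro x y q
  obtain ⟨γ, rfl⟩ := Path.Homotopic.Quotient.mk_surjective q
  exact gen U hU P hloc htr x y γ (fun t => hcov _)

/-- Nonabelian cocycle gives a functor from path classes to a group. -/
theorem exists_functor {X ι O : Type*} [TopologicalSpace X] [Group O]
    (U : ι → Set X) (hU : ∀ j, IsOpen (U j)) (hcov : ∀ x, ∃ j, x ∈ U j) (h : ι → X → O)
    (hh : ∀ j k x, x ∈ U j → x ∈ U k →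
      ∀ᶠ x' in 𝓝 x, (h k x')⁻¹ * h j x' = (h k x)⁻¹ * h j x) :
    ∃ Ψ : ∀ x y : X, Path.Homotopic.Quotient x y → O,
      (∀ x y z (a : Path.Homotopic.Quotient x y) (b : Path.Homotopic.Quotient y z),
        Ψ x z (a.trans b) = Ψ y z b * Ψ x y a) ∧
      ∀ j x y (γ : Path x y), (∀ t, γ t ∈ U j) → Ψ x y (.mk γ) = h j y * (h j x)⁻¹ := by
  classical
  let _ : TopologicalSpace O := ⊥
  have : DiscreteTopology O := ⟨rfl⟩
  choose i hi using hcov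
  let Z : FiberBundleCore ι X O :=
    { baseSet := U
      isOpen_baseSet := hU
      indexAt := i
      mem_baseSet_at := hi
      coordChange := fun j k x f => (h k x)⁻¹ * h j x * f
      coordChange_self := by intros; simp
      continuousOn_coordChange := by
        intro j k p hp
        apply ContinuousAt.continuousWithinAt
        have h1 := hh j k p.1 hp.1.1 hp.1.2
        have h2 : ∀ᶠ q in 𝓝 p, (h k q.1)⁻¹ * h j q.1 * q.2 = (h k p.1)⁻¹ * h j p.1 * p.2 := by
          have h3 : ∀ᶠ q in 𝓝 p, q.2 = p.2 := by
            have : Tendsto Prod.snd (𝓝 p) (𝓝 p.2) := continuous_snd.continuousAt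
            rw [nhds_discrete O] at this
            simpa using this
          have h4 := (continuous_fst.continuousAt (x := p)).eventually h1
          filter_upwards [h3, h4] with q a b
          rw [a, b]
        exact (continuousAt_const (y := (h k p.1)⁻¹ * h j p.1 * p.2)).congr
          (h2.mono fun _ hq => hq.symm)
      coordChange_comp := by
        intro j k l x _ v
        group }
  have cov : IsCoveringMap Z.proj := FiberBundle.isCoveringMap (F := O) (E := Z.Fiber)
  let val : Z.TotalSpace → O := fun e => h (i e.1) e.1 * (show O from e.2)
  have hval : ∀ x (o : O), ∃ e : Z.proj ⁻¹' {x}, val e.1 = o := by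
    intro x o
    refine ⟨⟨⟨x, ((h (i x) x)⁻¹ * o : O)⟩, rfl⟩, ?_⟩
    change h (i x) x * ((h (i x) x)⁻¹ * o) = o
    group
  have hlocal : ∀ j x y (γ : Path x y), (∀ t, γ t ∈ U j) → ∀ e : Z.proj ⁻¹' {x},
      val (cov.monodromy (.mk γ) e).1 = h j y * (h j x)⁻¹ * val e.1 := by
    intro j x y γ hγ e
    let f : O := (h j x)⁻¹ * val e.1
    let Γ : I → Z.TotalSpace := fun t => (Z.localTriv j).toOpenPartialHomeomorph.symm (γ t, f)
    have hΓ : Continuous Γ := by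
      apply ContinuousOn.comp_continuous (Z.localTriv j).toOpenPartialHomeomorph.continuousOn_symm
        (γ.continuous.prodMk continuous_const)
      intro t
      exact (Z.mem_localTriv_target j _).2 (hγ t)
    have hΓe : ∀ t, Γ t = ⟨γ t, ((h (i (γ t)) (γ t))⁻¹ * h j (γ t) * f : O)⟩ := by
      intro t
      rfl
    have h0 : Γ 0 = e.1 := by
      rw [hΓe]
      obtain ⟨⟨x', f'⟩, he⟩ := e
      obtain rfl : x' = x := he
      rw [γ.source]
      congr 1
      have hgrp : ∀ p q r : O, p⁻¹ * q * (q⁻¹ * (p * r)) = r := by intro p q r; group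
      exact hgrp _ _ _
    have hlift : Γ = cov.liftPath γ e.1 (γ.source.trans e.2.symm) :=
      (cov.eq_liftPath_iff _).2 ⟨hΓ, by ext t; rfl, h0⟩
    have h1 : (cov.monodromy (.mk γ) e).1 = Γ 1 := by
      rw [hlift]; rfl
    rw [h1, hΓe]
    change h (i (γ 1)) (γ 1) * ((h (i (γ 1)) (γ 1))⁻¹ * h j (γ 1) * ((h j x)⁻¹ * val e.1)) = _
    rw [γ.target]
    group
  have hex : ∀ x y (q : Path.Homotopic.Quotient x y), ∃ g : O, ∀ e : Z.proj ⁻¹' {x},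
      val (cov.monodromy q e).1 = g * val e.1 := by
    apply gen_all U hU (fun x => ⟨i x, hi x⟩)
    · intro j x y γ hγ
      exact ⟨_, hlocal j x y γ hγ⟩
    · rintro x y z a b ⟨g, hg⟩ ⟨g', hg'⟩
      refine ⟨g' * g, fun e => ?_⟩
      rw [cov.monodromy_trans_apply, hg', hg, mul_assoc]
  choose Ψ hΨ using hex
  have huniq : ∀ x y q g, (∀ e : Z.proj ⁻¹' {x}, val (cov.monodromy q e).1 = g * val e.1) →
      Ψ x y q = g := by
    intro x y q g hg
    obtain ⟨e, _⟩ := hval x 1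
    have := hΨ x y q e
    rw [hg e] at this
    exact (mul_right_cancel this).symm
  refine ⟨Ψ, ?_, ?_⟩
  · intro x y z a b
    apply huniq
    intro e
    rw [cov.monodromy_trans_apply, hΨ, hΨ, mul_assoc]
  · intro j x y γ hγ
    exact huniq _ _ _ _ (hlocal j x y γ hγ)

end FGP
end

section
open Set Topology Filter unitInterval

namespace FGP

theorem hnull_of_homotopy {X : Type*} [TopologicalSpace X] (U U' : Set X) (H : I × X → X)
    (hH : ContinuousOn H (univ ×ˢ U)) (h0 : ∀ x ∈ U, H (0, x) = x) (h1 : ∀ x ∈ U, H (1, x) ∈ U')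
    (hnull : ∀ x y (γ γ' : Path x y), (∀ t, γ t ∈ U') → (∀ t, γ' t ∈ U') → γ.Homotopic γ') :
    ∀ x y (γ γ' : Path x y), (∀ t, γ t ∈ U) → (∀ t, γ' t ∈ U) → γ.Homotopic γ' := by
  let f : C(U, X) := ⟨Subtype.val, continuous_subtype_val⟩
  have hHc : Continuous fun p : I × U => H (p.1, p.2.1) := by
    apply hH.comp_continuous (by fun_prop)
    intro p
    exact ⟨mem_univ _, p.2.2⟩
  let g : C(U, X) := ⟨fun x => H (1, x.1), hHc.comp (by fun_prop : Continuous fun x : U => ((1:I), x))⟩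
  let F : f.Homotopy g :=
    { toFun := fun p => H (p.1, p.2.1)
      continuous_toFun := hHc
      map_zero_left := fun x => h0 _ x.2
      map_one_left := fun x => rfl }
  intro x y γ γ' hγ hγ'
  have hx : x ∈ U := by simpa using hγ 0
  have hy : y ∈ U := by simpa using hγ 1
  have key : ∀ δ : Path x y, ∀ hδ : ∀ t, δ t ∈ U, ∃ δ' : Path (⟨x, hx⟩ : U) ⟨y, hy⟩,
      δ = δ'.map f.continuous := by
    intro δ hδ
    refine ⟨⟨⟨fun t => ⟨δ t, hδ t⟩, by fun_prop⟩, by simp, by simp⟩, ?_⟩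
    ext t; rfl
  obtain ⟨δ, rfl⟩ := key γ hγ
  obtain ⟨δ', rfl⟩ := key γ' hγ'
  have e1 := Path.Homotopic.Quotient.eq.2 (Path.Homotopic.map_trans_evalAt F δ)
  have e2 := Path.Homotopic.Quotient.eq.2 (Path.Homotopic.map_trans_evalAt F δ')
  have e3 := hnull _ _ (δ.map g.continuous) (δ'.map g.continuous) (fun t => h1 _ (δ t).2)
    (fun t => h1 _ (δ' t).2)
  rw [← Path.Homotopic.Quotient.eq] at e3
  simp only [Path.Homotopic.Quotient.mk_trans] at e1 e2
  rw [e3, ← e2] at e1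
  have := congrArg (fun q => Path.Homotopic.Quotient.trans q (Path.Homotopic.Quotient.symm (.mk (F.evalAt ⟨y, hy⟩)))) e1
  simp only [Path.Homotopic.Quotient.trans_assoc, Path.Homotopic.Quotient.trans_symm,
    Path.Homotopic.Quotient.trans_refl] at this
  exact Path.Homotopic.Quotient.eq.1 this

theorem hnull_of_contraction {X : Type*} [TopologicalSpace X] (U : Set X) (H : I × X → X) (c : X)
    (hH : ContinuousOn H (univ ×ˢ U)) (h0 : ∀ x ∈ U, H (0, x) = x) (h1 : ∀ x ∈ U, H (1, x) = c) :
    ∀ x y (γ γ' : Path x y), (∀ t, γ t ∈ U) → (∀ t, γ' t ∈ U) → γ.Homotopic γ' := by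
  refine hnull_of_homotopy U {c} H hH h0 h1 ?_
  intro x y γ γ' h h'
  have : γ = γ' := by
    ext t
    rw [show γ t = c from h t, show γ' t = c from h' t]
  rw [this]

/-- The abstract computation of the fundamental group. -/
theorem abstract_pi1 {X ι O : Type*} [TopologicalSpace X] [LocallyPathConnectedSpace X] [Group O]
    [Finite ι]
    (U : ι → Set X) (hU : ∀ j, IsOpen (U j)) (hcov : ∀ x, ∃ j, x ∈ U j) (j0 : ι) (h : ι → X → O)
    (hh : ∀ j k x, x ∈ U j → x ∈ U k →
      ∀ᶠ x' in 𝓝 x, (h k x')⁻¹ * h j x' = (h k x)⁻¹ * h j x)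
    (h0 : ∀ x, h j0 x = 1)
    (hdense : Dense (U j0)) (hconn : IsPathConnected (U j0))
    (hnull : ∀ j x y (γ γ' : Path x y), (∀ t, γ t ∈ U j) → (∀ t, γ' t ∈ U j) → γ.Homotopic γ')
    (x0 : X) (hx0 : x0 ∈ U j0)
    (H : ∀ cl : ∀ x y : X, Path.Homotopic.Quotient x y → FundamentalGroup X x0,
      (∀ x y z (a : Path.Homotopic.Quotient x y) (b : Path.Homotopic.Quotient y z), cl x z (a.trans b) = cl y z b * cl x y a) →
      (∀ x y (γ : Path x y), (∀ t, γ t ∈ U j0) → cl x y (.mk γ) = 1) →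
      (∀ x, ∃ x' ∈ U j0, ∃ γ : Path x' x, (∀ j, x ∈ U j → ∀ t, γ t ∈ U j) ∧
        cl x' x (.mk γ) = 1) →
      ∃ Φ : O →* FundamentalGroup X x0,
        (∀ j x y, x ∈ U j → x ∈ U j0 → y ∈ U j → y ∈ U j0 →
          ∃ γ : Path x y, (∀ t, γ t ∈ U j) ∧ cl x y (.mk γ) ∈ Φ.range) ∧
        ∃ S : Set O, Subgroup.closure S = ⊤ ∧ ∀ s ∈ S, ∃ j x y, ∃ γ : Path x y, x ∈ U j0 ∧
          y ∈ U j0 ∧ (∀ t, γ t ∈ U j) ∧ cl x y (.mk γ) = Φ s ∧ h j y * (h j x)⁻¹ = s) :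
    ∀ x : X, Nonempty (FundamentalGroup X x ≃* O) := by
  classical
  obtain ⟨Ψ, hΨt, hΨl⟩ := exists_functor U hU hcov h hh
  have hΨ0 : ∀ x y (γ : Path x y), (∀ t, γ t ∈ U j0) → Ψ x y (.mk γ) = 1 := by
    intro x y γ hγ
    rw [hΨl j0 x y γ hγ]; simp [h0]
  have hΨr : ∀ x, Ψ x x (.refl x) = 1 := by
    intro x
    have := hΨt x x x (.refl x) (.refl x)
    rw [Path.Homotopic.Quotient.trans_refl] at this
    simpa using this
  have hΨs : ∀ x y (a : Path.Homotopic.Quotient x y), Ψ y x a.symm = (Ψ x y a)⁻¹ := by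
    intro x y a
    have := hΨt x y x a a.symm
    rw [Path.Homotopic.Quotient.trans_symm, hΨr] at this
    exact eq_inv_of_mul_eq_one_left this.symm
  -- the connecting paths
  have H1 : ∀ x, ∃ x' ∈ U j0, ∃ γ : Path x' x, ∀ j, x ∈ U j → ∀ t, γ t ∈ U j := by
    intro x
    let N : Set X := ⋂ j : {j // x ∈ U j}, U j.1
    have hN : IsOpen N := isOpen_iInter_of_finite fun j => hU _
    have hxN : x ∈ N := mem_iInter.2 fun j => j.2
    obtain ⟨W, ⟨hW, hWc⟩, hWN⟩ := (LocallyPathConnectedSpace.path_connected_basis x).mem_iff.1 (hN.mem_nhds hxN)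
    obtain ⟨x', hx', hx'0⟩ := hdense.inter_nhds_nonempty hW
    obtain ⟨γ, hγ⟩ := hWc.joinedIn x' hx'0 x (mem_of_mem_nhds hW)
    exact ⟨x', hx', γ, fun j hj t => mem_iInter.1 (hWN (hγ t)) ⟨j, hj⟩⟩
  choose x' hx' γ' hγ' using H1
  have Hκ : ∀ x, ∃ γ : Path x0 (x' x), ∀ t, γ t ∈ U j0 := by
    intro x
    obtain ⟨γ, hγ⟩ := hconn.joinedIn x0 hx0 (x' x) (hx' x)
    exact ⟨γ, hγ⟩
  choose κ hκ using Hκ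
  let c : ∀ x, Path.Homotopic.Quotient x0 x := fun x => (Path.Homotopic.Quotient.mk (κ x)).trans (.mk (γ' x))
  have hc : ∀ x ∈ U j0, ∃ γ : Path x0 x, (∀ t, γ t ∈ U j0) ∧ c x = .mk γ := by
    intro x hx
    refine ⟨(κ x).trans (γ' x), ?_, rfl⟩
    intro t
    have : ((κ x).trans (γ' x)) t ∈ range ((κ x).trans (γ' x)) := ⟨t, rfl⟩
    rw [Path.trans_range] at this
    rcases this with ⟨s, hs⟩ | ⟨s, hs⟩
    · rw [← hs]; exact hκ _ _
    · rw [← hs]; exact hγ' _ _ hx _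
  have hcΨ : ∀ x ∈ U j0, Ψ _ _ (c x) = 1 := by
    intro x hx
    obtain ⟨γ, hγ, e⟩ := hc x hx
    rw [e, hΨ0 _ _ _ hγ]
  let cl : ∀ x y : X, Path.Homotopic.Quotient x y → FundamentalGroup X x0 := fun x y q =>
    ((c x).trans q).trans (c y).symm
  have hclt : ∀ x y z (a : Path.Homotopic.Quotient x y) (b : Path.Homotopic.Quotient y z),
      cl x z (a.trans b) = cl y z b * cl x y a := by
    intro x y z a b
    rw [FundamentalGroup.mul_def]
    simp only [cl, Path.Homotopic.Quotient.trans_assoc]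
    rw [← Path.Homotopic.Quotient.trans_assoc (c y).symm (c y), Path.Homotopic.Quotient.symm_trans, Path.Homotopic.Quotient.refl_trans]
  have hmem : ∀ {j x y z} (γ : Path x y) (δ : Path y z), (∀ t, γ t ∈ U j) → (∀ t, δ t ∈ U j) →
      ∀ t, (γ.trans δ) t ∈ U j := by
    intro j x y z γ δ hγ hδ t
    have : (γ.trans δ) t ∈ range (γ.trans δ) := ⟨t, rfl⟩
    rw [Path.trans_range] at this
    rcases this with ⟨s, hs⟩ | ⟨s, hs⟩
    · rw [← hs]; exact hγ _
    · rw [← hs]; exact hδ _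
  have hcl0 : ∀ x y (γ : Path x y), (∀ t, γ t ∈ U j0) → cl x y (.mk γ) = 1 := by
    intro x y γ hγ
    obtain ⟨α, hα, ea⟩ := hc x (by simpa using hγ 0)
    obtain ⟨β, hβ, eb⟩ := hc y (by simpa using hγ 1)
    have : c y = (c x).trans (.mk γ) := by
      rw [ea, eb, ← Path.Homotopic.Quotient.mk_trans]
      exact Path.Homotopic.Quotient.eq.2 (hnull j0 _ _ _ _ hβ (hmem _ _ hα hγ))
    change ((c x).trans (.mk γ)).trans (c y).symm = Path.Homotopic.Quotient.refl x0
    rw [← this, Path.Homotopic.Quotient.trans_symm]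
  have ec0 : ∀ z, c (x' z) = .mk (κ z) := by
    intro z
    obtain ⟨α, hα, ea⟩ := hc (x' z) (hx' z)
    rw [ea]
    exact Path.Homotopic.Quotient.eq.2 (hnull j0 _ _ _ _ hα (hκ z))
  have hcl1 : ∀ x, ∃ x' ∈ U j0, ∃ γ : Path x' x, (∀ j, x ∈ U j → ∀ t, γ t ∈ U j) ∧
      cl x' x (.mk γ) = 1 := by
    intro x
    refine ⟨x' x, hx' x, γ' x, hγ' x, ?_⟩
    change ((c (x' x)).trans (.mk (γ' x))).trans (c x).symm = Path.Homotopic.Quotient.refl x0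
    rw [ec0]
    exact Path.Homotopic.Quotient.trans_symm (c x)
  obtain ⟨Φ, hΦr, S, hS, hΦS⟩ := H cl hclt hcl0 hcl1
  let Ψ0 : FundamentalGroup X x0 →* O := MonoidHom.mk' (fun q => Ψ x0 x0 q) (by
    intro a b
    rw [FundamentalGroup.mul_def, hΨt])
  have hinj : Ψ0.comp Φ = MonoidHom.id O := by
    apply MonoidHom.eq_of_eqOn_dense hS
    intro s hs
    obtain ⟨j, x, y, γ, hx, hy, hγ, e1, e2⟩ := hΦS s hs
    simp only [MonoidHom.comp_apply, MonoidHom.id_apply]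
    rw [← e1, ← e2]
    change Ψ x0 x0 (((c x).trans (.mk γ)).trans (c y).symm) = _
    rw [hΨt, hΨt, hΨs, hcΨ x hx, hcΨ y hy, hΨl j _ _ _ hγ]
    simp
  have hsurjP : ∀ x y (q : Path.Homotopic.Quotient x y), cl x y q ∈ Φ.range := by
    apply gen_all U hU hcov
    · intro j x y γ hγ
      have hx : x ∈ U j := by simpa using hγ 0
      have hy : y ∈ U j := by simpa using hγ 1
      have hxj : x' x ∈ U j := by simpa using hγ' x j hx 0
      have hyj : x' y ∈ U j := by simpa using hγ' y j hy 0
      obtain ⟨δ, hδ, hr⟩ := hΦr j (x' x) (x' y) hxj (hx' x) hyj (hx' y)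
      have e1 : (Path.Homotopic.Quotient.mk δ) = (Path.Homotopic.Quotient.mk (γ' x)).trans
          ((Path.Homotopic.Quotient.mk γ).trans (Path.Homotopic.Quotient.mk (γ' y)).symm) := by
        rw [← Path.Homotopic.Quotient.mk_symm, ← Path.Homotopic.Quotient.mk_trans, ← Path.Homotopic.Quotient.mk_trans]
        refine Path.Homotopic.Quotient.eq.2 (hnull j _ _ _ _ hδ ?_)
        exact hmem _ _ (hγ' x j hx) (hmem _ _ hγ (fun t => hγ' y j hy _))
      have ec : ∀ z, c (x' z) = .mk (κ z) := by
        intro z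
        obtain ⟨α, hα, ea⟩ := hc (x' z) (hx' z)
        rw [ea]
        exact Path.Homotopic.Quotient.eq.2 (hnull j0 _ _ _ _ hα (hκ z))
      have e2 : cl x y (.mk γ) = cl (x' x) (x' y) (.mk δ) := by
        change ((c x).trans (.mk γ)).trans (c y).symm =
          ((c (x' x)).trans (.mk δ)).trans (c (x' y)).symm
        have hs : (c y).symm = (Path.Homotopic.Quotient.mk (γ' y)).symm.trans (Path.Homotopic.Quotient.mk (κ y)).symm := by
          have e : ((c y).symm.trans ((c y).trans ((Path.Homotopic.Quotient.mk (γ' y)).symm.trans (Path.Homotopic.Quotient.mk (κ y)).symm))) = (c y).symm := by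
            have : (c y).trans ((Path.Homotopic.Quotient.mk (γ' y)).symm.trans (Path.Homotopic.Quotient.mk (κ y)).symm) = .refl _ := by
              simp only [c, Path.Homotopic.Quotient.trans_assoc]
              rw [← Path.Homotopic.Quotient.trans_assoc (.mk (γ' y)), Path.Homotopic.Quotient.trans_symm, Path.Homotopic.Quotient.refl_trans,
                Path.Homotopic.Quotient.trans_symm]
            rw [this, Path.Homotopic.Quotient.trans_refl]
          rw [← Path.Homotopic.Quotient.trans_assoc, Path.Homotopic.Quotient.symm_trans, Path.Homotopic.Quotient.refl_trans] at e
          exact e.symm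
        rw [ec, ec, e1, hs]
        simp only [c, Path.Homotopic.Quotient.trans_assoc]
      rw [e2]; exact hr
    · intro x y z a b ha hb
      rw [hclt]
      exact Φ.range.mul_mem hb ha
  have hsurj : Function.Surjective Φ := by
    intro q
    have := hsurjP x0 x0 q
    obtain ⟨α, hα, ea⟩ := hc x0 hx0
    have e : c x0 = .refl x0 := by
      rw [ea, ← Path.Homotopic.Quotient.mk_refl]
      exact Path.Homotopic.Quotient.eq.2 (hnull j0 _ _ _ _ hα (fun t => by simpa using hx0))
    have e2 : cl x0 x0 q = q := by
      change ((c x0).trans q).trans (c x0).symm = q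
      rw [e, Path.Homotopic.Quotient.refl_trans, ← Path.Homotopic.Quotient.mk_refl, ← Path.Homotopic.Quotient.mk_symm, Path.refl_symm,
        Path.Homotopic.Quotient.mk_refl, Path.Homotopic.Quotient.trans_refl]
    rw [e2] at this
    exact this
  have hbij : Function.Bijective Φ := by
    refine ⟨fun a b hab => ?_, hsurj⟩
    have := congrArg Ψ0 hab
    simpa using (DFunLike.congr_fun hinj a).symm.trans (this.trans (DFunLike.congr_fun hinj b))
  intro x
  exact ⟨(FundamentalGroup.fundamentalGroupMulEquivOfPath ((κ x).trans (γ' x))).symm.trans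
    (MulEquiv.ofBijective Φ hbij).symm⟩

end FGP
end

section
open Set Topology Filter unitInterval

namespace FGP

/-- Closed cone truncated: the ray starting at `1`. -/
def Ray : Set ℂ := {z | 1 ≤ z.re ∧ z.im = 0}

/-- An open truncated cone about the ray. -/
def Cone (ε : ℝ) : Set ℂ := {z | 1 < z.re ∧ |z.im| < ε * z.re}

theorem isClosed_Ray : IsClosed Ray := by
  apply IsClosed.inter
  · exact isClosed_le continuous_const Complex.continuous_re
  · exact isClosed_eq Complex.continuous_im continuous_const

theorem isOpen_Cone (ε : ℝ) : IsOpen (Cone ε) := by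
  apply IsOpen.inter
  · exact isOpen_lt continuous_const Complex.continuous_re
  · exact isOpen_lt Complex.continuous_im.abs (continuous_const.mul Complex.continuous_re)

theorem convex_Cone (ε : ℝ) : Convex ℝ (Cone ε) := by
  rintro z ⟨hz1, hz2⟩ w ⟨hw1, hw2⟩ a b ha hb hab
  simp only [abs_lt] at hz2 hw2
  refine ⟨?_, abs_lt.2 ⟨?_, ?_⟩⟩ <;>
  simp only [Complex.add_re, Complex.add_im, Complex.real_smul, Complex.mul_re, Complex.mul_im,
      Complex.ofReal_re, Complex.ofReal_im, zero_mul, sub_zero, add_zero]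
  · rcases ha.lt_or_eq with h | h
    · nlinarith
    · subst h; nlinarith
  · rcases ha.lt_or_eq with h | h
    · nlinarith
    · subst h; nlinarith
  · rcases ha.lt_or_eq with h | h
    · nlinarith
    · subst h; nlinarith

theorem zero_notMem_Cone (ε : ℝ) : (0 : ℂ) ∉ Cone ε := by
  rintro ⟨h, -⟩
  simp at h
  linarith

theorem pathconn_W (p : ℂ) (hp : p ≠ 0) (W : Set ℂ) (hW : Convex ℝ W) (hne : W.Nonempty)
    (h0 : (0 : ℂ) ∉ W) : IsPathConnected {q : ℂ × ℂ | q.1 * q.2 / p ∈ W} := by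
  have h1 : IsPathConnected (W ×ˢ ({0}ᶜ : Set ℂ)) :=
    (hW.isPathConnected hne).prod (isPathConnected_compl_singleton_of_one_lt_rank
      (by rw [Complex.rank_real_complex]; norm_num) 0)
  have h2 := h1.image' (f := fun x : ℂ × ℂ => (x.2, x.1 * p / x.2)) (by
    apply ContinuousOn.prodMk (by fun_prop)
    apply ContinuousOn.div (by fun_prop) (by fun_prop)
    rintro ⟨a, b⟩ ⟨_, hb⟩
    exact hb)
  convert h2 using 1
  ext ⟨y, z⟩
  simp only [mem_ofPred_eq, mem_image, mem_prod, mem_compl_iff, mem_singleton_iff, Prod.exists,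
    Prod.mk.injEq]
  constructor
  · intro h
    have hy : y ≠ 0 := by
      rintro rfl
      apply h0; simpa using h
    refine ⟨y * z / p, y, ⟨h, hy⟩, rfl, ?_⟩
    field_simp
  · rintro ⟨a, b, ⟨ha, hb⟩, rfl, rfl⟩
    convert ha using 1
    field_simp

theorem dense_complement_rays {n : ℕ} (p : Fin (n+1) → ℂ) (hp : ∀ i, p i ≠ 0) (q : ℂ × ℂ) :
    q ∈ closure {q : ℂ × ℂ | ∀ i, q.1 * q.2 / p i ∉ Ray} := by
  by_cases hq : q.1 * q.2 = 0
  · apply subset_closure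
    intro i
    rw [hq]
    rintro ⟨h, -⟩
    simp at h
    linarith
  have hq2 : q.2 ≠ 0 := right_ne_zero_of_mul hq
  -- rotate the second coordinate
  let f : ℂ → ℂ × ℂ := fun t => (q.1, q.2 * t)
  have hf : ContinuousAt f 1 := by fun_prop
  have h1 : f 1 = q := by simp [f]
  -- bad parameters on the unit-circle-like line 1 + i s are finite
  let g : ℝ → ℂ × ℂ := fun s => f (1 + s * Complex.I)
  have hg : Tendsto g (𝓝[≠] 0) (𝓝 q) := by
    have : Continuous g := by fun_prop
    have h2 : Tendsto g (𝓝 0) (𝓝 (g 0)) := this.continuousAt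
    have h3 : g 0 = q := by simp [g, f]
    rw [h3] at h2
    exact h2.mono_left nhdsWithin_le_nhds
  apply mem_closure_of_tendsto hg
  simp only [mem_ofPred_eq, eventually_all]
  intro i
  have key : ∀ s : ℝ, (g s).1 * (g s).2 / p i ∈ Ray → ((q.1 * q.2 / p i).im + s * (q.1 * q.2 / p i).re = 0) := by
    rintro s ⟨-, h⟩
    have : (g s).1 * (g s).2 / p i = (q.1 * q.2 / p i) * (1 + s * Complex.I) := by
      simp only [g, f]; ring
    rw [this] at h
    simp at h
    linarith
  set c := q.1 * q.2 / p i with hc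
  have hc0 : c ≠ 0 := div_ne_zero hq (hp i)
  by_cases hre : c.re = 0
  · filter_upwards with s hs
    have := key s hs
    rw [hre] at this
    apply hc0
    apply Complex.ext <;> simp [hre]
    linarith
  · by_cases him : c.im = 0
    · have : ∀ᶠ s : ℝ in 𝓝[≠] 0, s ≠ 0 := eventually_mem_nhdsWithin
      filter_upwards [this] with s hs h
      have := key s h
      rw [him, zero_add] at this
      rcases mul_eq_zero.1 this with h' | h'
      · exact hs h'
      · exact hre h'
    · have : ∀ᶠ s : ℝ in 𝓝 0, c.im + s * c.re ≠ 0 := by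
        apply ContinuousAt.eventually_ne (by fun_prop)
        simpa using him
      filter_upwards [this.filter_mono nhdsWithin_le_nhds] with s hs h
      exact hs (key s h)

end FGP
end

section
open Set Topology Filter unitInterval

namespace FGP

/-- The local model of the complement. -/
structure Model (X : Type) [TopologicalSpace X] (n m : ℕ) (α : Type) where
  hm : 0 < m
  p : Fin (n + 1) → ℂ
  hp : ∀ i, p i ≠ 0
  e : OpenPartialHomeomorph X (ℂ × ℂ)
  he : e.target = {q | ∀ i, q.1 * q.2 ≠ p i}
  hed : Dense e.source
  ε : ℝ
  hε : 0 < ε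
  hε1 : ε ≤ 1
  hcone : ∀ i j, i ≠ j → ∀ d : ℂ, |(d / p i).im| < ε * (d / p i).re →
    ¬ |(d / p j).im| < ε * (d / p j).re
  Q : α → Set X
  hQ : ∀ a, IsOpen (Q a)
  hcov : ∀ x, x ∉ e.source → ∃ a, x ∈ Q a
  w : α → X → ℂ
  hw : ∀ a, ContinuousOn (w a) (Q a)
  hwe : ∀ a x, x ∈ Q a → (w a x ≠ 0 ↔ x ∈ e.source)
  hwd : ∀ a x, x ∈ Q a → x ∈ e.source → (e x).1 * (e x).2 = p 0 * (1 + w a x ^ m)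
  hwε : ∀ a x, x ∈ Q a → ‖w a x ^ m‖ < ε / 2
  hQnull : ∀ a x y (γ γ' : Path x y), (∀ t, γ t ∈ Q a) → (∀ t, γ' t ∈ Q a) → γ.Homotopic γ'
  hQconn : ∀ a x y, x ∈ Q a → x ∈ e.source → y ∈ Q a → y ∈ e.source →
    JoinedIn (Q a ∩ e.source) x y
  E : α → X → ℂ
  hE1 : ∀ a x, E a x ^ m = 1
  hE : ∀ a b x, x ∈ Q a → x ∈ Q b → ∃ ζ : ℂ, ζ ^ m = 1 ∧
    ∀ᶠ x' in 𝓝 x, w a x' = ζ * w b x' ∧ E a x' = ζ * E b x'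
  a0 : α
  ρ : ℝ
  hρ : 0 < ρ
  F : ℝ → X
  hF : Continuous F
  hFQ : ∀ θ, F θ ∈ Q a0
  hFw : ∀ θ : ℝ, w a0 (F θ) = ρ * Complex.exp (θ * Complex.I)
  hFper : ∀ θ, F (θ + 2 * Real.pi) = F θ

namespace Model

variable {X : Type} [TopologicalSpace X] {n m : ℕ} {α : Type} (M : Model X n m α)

/-- The function `yz` divided by the `i`-th puncture. -/
noncomputable def om (i : Fin (n + 1)) (x : X) : ℂ := (M.e x).1 * (M.e x).2 / M.p i

/-- The big contractible piece. -/
def U0 : Set X := {x | x ∈ M.e.source ∧ ∀ i, M.om i x ∉ Ray}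

/-- The cone pieces. -/
def VV (i : Fin (n + 1)) : Set X := {x | x ∈ M.e.source ∧ M.om i x ∈ Cone M.ε}

theorem continuousOn_om (i) : ContinuousOn (M.om i) M.e.source := by
  have := M.e.continuousOn
  unfold om
  exact ((continuous_fst.comp_continuousOn this).mul (continuous_snd.comp_continuousOn this)).div_const _

theorem isOpen_U0 : IsOpen M.U0 := by
  have : M.U0 = ⋂ i, (M.e.source ∩ M.om i ⁻¹' Rayᶜ) := by
    ext x
    simp only [U0, mem_ofPred_eq, mem_iInter, mem_inter_iff, mem_preimage, mem_compl_iff]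
    constructor
    · rintro ⟨h, h'⟩ i; exact ⟨h, h' i⟩
    · intro h; exact ⟨(h 0).1, fun i => (h i).2⟩
  rw [this]
  exact isOpen_iInter_of_finite fun i =>
    (M.continuousOn_om i).isOpen_inter_preimage M.e.open_source isClosed_Ray.isOpen_compl

theorem isOpen_VV (i) : IsOpen (M.VV i) :=
  (M.continuousOn_om i).isOpen_inter_preimage M.e.open_source (isOpen_Cone _)

theorem one_mem_Ray : (1 : ℂ) ∈ Ray := by simp [Ray]

theorem mem_target_of (q : ℂ × ℂ) (h : ∀ i, q.1 * q.2 / M.p i ∉ Ray) : q ∈ M.e.target := by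
  rw [M.he]
  intro i hi
  apply h i
  rw [hi, div_self (M.hp i)]
  exact one_mem_Ray

theorem not_cone (i j) (hij : i ≠ j) (d : ℂ) (h : d / M.p i ∈ Cone M.ε) :
    |(d / M.p j).im| < M.ε * (d / M.p j).re → False :=
  M.hcone i j hij d h.2

theorem cone_notMem_Ray (i j) (hij : i ≠ j) (d : ℂ) (h : d / M.p i ∈ Cone M.ε) :
    d / M.p j ∉ Ray := by
  rintro ⟨h1, h2⟩
  apply M.not_cone i j hij d h
  rw [h2, abs_zero]
  have := M.hε
  positivity

theorem mem_target_of_cone (i) (q : ℂ × ℂ) (h : q.1 * q.2 / M.p i ∈ Cone M.ε) :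
    q ∈ M.e.target := by
  rw [M.he]
  intro j hj
  by_cases hij : i = j
  · subst hij
    rw [hj, div_self (M.hp i)] at h
    exact absurd h.1 (by simp)
  · apply M.cone_notMem_Ray i j hij _ h
    rw [hj, div_self (M.hp j)]
    exact one_mem_Ray

theorem cone_U0 (i) (x : X) (h : x ∈ M.VV i) (him : (M.om i x).im ≠ 0) : x ∈ M.U0 := by
  refine ⟨h.1, fun j => ?_⟩
  by_cases hij : i = j
  · subst hij
    exact fun h' => him h'.2
  · exact M.cone_notMem_Ray i j hij _ h.2

theorem im_ne_zero (i) (x : X) (h : x ∈ M.VV i) (h0 : x ∈ M.U0) : (M.om i x).im ≠ 0 := by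
  intro h'
  exact h0.2 i ⟨h.2.1.le, h'⟩

theorem source_cover (x : X) (h : x ∈ M.e.source) : x ∈ M.U0 ∨ ∃ i, x ∈ M.VV i := by
  by_cases h0 : x ∈ M.U0
  · exact Or.inl h0
  · right
    have : ∃ i, M.om i x ∈ Ray := by
      by_contra hc
      push Not at hc
      exact h0 ⟨h, hc⟩
    obtain ⟨i, h1, h2⟩ := this
    refine ⟨i, h, ?_, ?_⟩
    · rcases h1.lt_or_eq with h1 | h1
      · exact h1
      · exfalso
        have ht := M.e.map_source h
        rw [M.he] at ht
        apply ht i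
        have : M.om i x = 1 := Complex.ext h1.symm (by simpa using h2)
        unfold om at this
        rwa [div_eq_one_iff_eq (M.hp i)] at this
    · rw [h2, abs_zero]
      have := M.hε
      positivity

theorem U0_eq : M.U0 = M.e.symm '' {q : ℂ × ℂ | ∀ i, q.1 * q.2 / M.p i ∉ Ray} := by
  ext x
  constructor
  · rintro ⟨h, h'⟩
    exact ⟨M.e x, h', M.e.left_inv h⟩
  · rintro ⟨q, hq, rfl⟩
    have ht := M.mem_target_of q hq
    refine ⟨M.e.map_target ht, fun i => ?_⟩
    unfold om
    rw [M.e.right_inv ht]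
    exact hq i

theorem starConvex_D0 : StarConvex ℝ 0 {q : ℂ × ℂ | ∀ i, q.1 * q.2 / M.p i ∉ Ray} := by
  rw [starConvex_zero_iff]
  intro q hq a ha0 ha1 i hi
  have e1 : (a • q).1 * (a • q).2 / M.p i = ((a ^ 2 : ℝ) : ℂ) * (q.1 * q.2 / M.p i) := by
    simp; ring
  rw [e1] at hi
  obtain ⟨h1, h2⟩ := hi
  rw [Complex.re_ofReal_mul] at h1
  rw [Complex.im_ofReal_mul] at h2
  have ha : a ≠ 0 := by rintro rfl; simp at h1; linarith
  apply hq i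
  refine ⟨?_, ?_⟩
  · by_contra hc
    push Not at hc
    have h3 : 0 < a ^ 2 := by positivity
    have h4 : a ^ 2 ≤ 1 := by nlinarith
    nlinarith
  · rcases mul_eq_zero.1 h2 with h | h
    · exact absurd h (by positivity)
    · exact h

theorem zero_D0 : (0 : ℂ × ℂ) ∈ {q : ℂ × ℂ | ∀ i, q.1 * q.2 / M.p i ∉ Ray} := by
  intro i
  rintro ⟨h, -⟩
  simp at h
  linarith

theorem pathconn_U0 : IsPathConnected M.U0 := by
  rw [U0_eq]
  apply (M.starConvex_D0.isPathConnected M.zero_D0).image'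
  exact M.e.continuousOn_symm.mono fun q hq => M.mem_target_of q hq

theorem dense_U0 : Dense M.U0 := by
  have h1 : M.e.source ⊆ closure M.U0 := by
    intro x hx
    have := dense_complement_rays M.p M.hp (M.e x)
    have h2 := (M.e.continuousAt_symm (M.e.map_source hx)).continuousWithinAt.mem_closure_image this
    rw [M.e.left_inv hx] at h2
    rw [U0_eq]
    exact h2
  intro x
  have := closure_mono h1 (M.hed x)
  rwa [closure_closure] at this

theorem hnull_lift (U U' : Set X) (hU : U ⊆ M.e.source) (G : I × (ℂ × ℂ) → ℂ × ℂ)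
    (hG : ContinuousOn G (univ ×ˢ (M.e '' U))) (hGt : ∀ t, ∀ x ∈ U, G (t, M.e x) ∈ M.e.target)
    (h0 : ∀ x ∈ U, G (0, M.e x) = M.e x) (h1 : ∀ x ∈ U, M.e.symm (G (1, M.e x)) ∈ U')
    (hnull : ∀ x y (γ γ' : Path x y), (∀ t, γ t ∈ U') → (∀ t, γ' t ∈ U') → γ.Homotopic γ') :
    ∀ x y (γ γ' : Path x y), (∀ t, γ t ∈ U) → (∀ t, γ' t ∈ U) → γ.Homotopic γ' := by
  apply hnull_of_homotopy U U' (fun q => M.e.symm (G (q.1, M.e q.2))) _ _ h1 hnull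
  · refine M.e.continuousOn_symm.comp (t := M.e.target) ?_ ?_
    · refine hG.comp (t := univ ×ˢ (M.e '' U)) ?_ ?_
      · apply ContinuousOn.prodMk (by fun_prop)
        exact (M.e.continuousOn.mono hU).comp continuousOn_snd (fun q hq => hq.2)
      · rintro q hq
        exact ⟨mem_univ _, mem_image_of_mem _ hq.2⟩
    · rintro q hq
      exact hGt _ _ hq.2
  · intro x hx
    simp only
    rw [h0 x hx, M.e.left_inv (hU hx)]

theorem hnull_U0 : ∀ x y (γ γ' : Path x y), (∀ t, γ t ∈ M.U0) → (∀ t, γ' t ∈ M.U0) →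
    γ.Homotopic γ' := by
  apply M.hnull_lift M.U0 {M.e.symm 0} (fun x hx => hx.1) (fun q => (1 - (q.1 : ℝ)) • q.2)
  · fun_prop
  · intro t x hx
    apply M.mem_target_of
    exact starConvex_zero_iff.1 M.starConvex_D0 hx.2 (by linarith [t.2.2]) (by linarith [t.2.1])
  · intro x hx; simp
  · intro x hx; simp
  · intro x y γ γ' h h'
    have : γ = γ' := by
      ext t
      rw [show γ t = _ from h t, show γ' t = _ from h' t]
    rw [this]

theorem star_mem_Cone : (⟨2, M.ε⟩ : ℂ) ∈ Cone M.ε := by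
  have := M.hε
  refine ⟨by norm_num, ?_⟩
  simp only [abs_of_pos this]
  linarith

theorem star_mem_Cone_neg : (⟨2, -M.ε⟩ : ℂ) ∈ Cone M.ε := by
  have := M.hε
  refine ⟨by norm_num, ?_⟩
  simp only [abs_neg, abs_of_pos this]
  linarith

theorem hnull_VV (i) : ∀ x y (γ γ' : Path x y), (∀ t, γ t ∈ M.VV i) → (∀ t, γ' t ∈ M.VV i) →
    γ.Homotopic γ' := by
  have hp := M.hp i
  have hne : ∀ x ∈ M.VV i, (M.e x).1 * (M.e x).2 ≠ 0 := by
    intro x hx h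
    apply zero_notMem_Cone M.ε
    have := hx.2
    unfold om at this
    rwa [h, zero_div] at this
  let o : ℂ := ⟨2, M.ε⟩
  -- the homotopy pushes the product linearly to `o * p i`
  let G : I × (ℂ × ℂ) → ℂ × ℂ := fun q => (q.2.1,
    q.2.2 * (((1 - (q.1 : ℝ) : ℝ) : ℂ) + ((q.1 : ℝ) : ℂ) * (o * M.p i) / (q.2.1 * q.2.2)))
  have hGp : ∀ t : I, ∀ x ∈ M.VV i, (G (t, M.e x)).1 * (G (t, M.e x)).2 / M.p i =
      (1 - (t : ℝ)) • M.om i x + (t : ℝ) • o := by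
    intro t x hx
    have h := hne x hx
    have h1 := left_ne_zero_of_mul h
    have h2 := right_ne_zero_of_mul h
    simp only [G, om, Complex.real_smul]
    field_simp
  have hGc : ∀ t : I, ∀ x ∈ M.VV i, (G (t, M.e x)).1 * (G (t, M.e x)).2 / M.p i ∈ Cone M.ε := by
    intro t x hx
    rw [hGp t x hx]
    exact convex_Cone M.ε hx.2 M.star_mem_Cone (by linarith [t.2.2]) t.2.1 (by ring)
  apply M.hnull_lift (M.VV i) M.U0 (fun x hx => hx.1) G
  · rintro ⟨t, q⟩ ⟨-, x, hx, rfl⟩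
    have h := hne x hx
    apply ContinuousAt.continuousWithinAt
    simp only [G]
    apply ContinuousAt.prodMk (by fun_prop)
    apply ContinuousAt.mul (by fun_prop)
    apply ContinuousAt.add (by fun_prop)
    exact ContinuousAt.div (by fun_prop) (by fun_prop) h
  · intro t x hx
    exact M.mem_target_of_cone i _ (hGc t x hx)
  · intro x hx
    simp [G]
  · intro x hx
    have ht := M.mem_target_of_cone i _ (hGc 1 x hx)
    have e1 : M.om i (M.e.symm (G (1, M.e x))) = o := by
      unfold om
      rw [M.e.right_inv ht, hGp 1 x hx]
      simp
    apply M.cone_U0 i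
    · refine ⟨M.e.map_target ht, ?_⟩
      rw [e1]; exact M.star_mem_Cone
    · rw [e1]; exact M.hε.ne'
  · exact M.hnull_U0

theorem VV_sub_pathconn (i) (W : Set ℂ) (hW : Convex ℝ W) (hne : W.Nonempty)
    (hWC : W ⊆ Cone M.ε) : IsPathConnected {x | x ∈ M.e.source ∧ M.om i x ∈ W} := by
  have h1 := pathconn_W (M.p i) (M.hp i) W hW hne (fun h => zero_notMem_Cone M.ε (hWC h))
  have h2 := h1.image' (f := M.e.symm) (M.e.continuousOn_symm.mono fun q hq =>
    M.mem_target_of_cone i q (hWC hq))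
  convert h2 using 1
  ext x
  constructor
  · rintro ⟨h, h'⟩
    exact ⟨M.e x, h', M.e.left_inv h⟩
  · rintro ⟨q, hq, rfl⟩
    have ht := M.mem_target_of_cone i q (hWC hq)
    refine ⟨M.e.map_target ht, ?_⟩
    unfold om
    rw [M.e.right_inv ht]
    exact hq

theorem joined_pos (i) (x y : X) (hx : x ∈ M.VV i) (hy : y ∈ M.VV i) (hx' : 0 < (M.om i x).im)
    (hy' : 0 < (M.om i y).im) : JoinedIn (M.VV i ∩ M.U0) x y := by
  have h := M.VV_sub_pathconn i (Cone M.ε ∩ {z | 0 < z.im})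
    ((convex_Cone _).inter (convex_halfSpace_im_gt 0)) ⟨_, M.star_mem_Cone, M.hε⟩ inter_subset_left
  refine (h.joinedIn x ⟨hx.1, hx.2, hx'⟩ y ⟨hy.1, hy.2, hy'⟩).mono ?_
  rintro z ⟨h1, h2, h3⟩
  exact ⟨⟨h1, h2⟩, M.cone_U0 i z ⟨h1, h2⟩ (ne_of_gt h3)⟩

theorem joined_neg (i) (x y : X) (hx : x ∈ M.VV i) (hy : y ∈ M.VV i) (hx' : (M.om i x).im < 0)
    (hy' : (M.om i y).im < 0) : JoinedIn (M.VV i ∩ M.U0) x y := by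
  have h := M.VV_sub_pathconn i (Cone M.ε ∩ {z | z.im < 0})
    ((convex_Cone _).inter (convex_halfSpace_im_lt 0))
    ⟨_, M.star_mem_Cone_neg, by have := M.hε; change -M.ε < 0; linarith⟩ inter_subset_left
  refine (h.joinedIn x ⟨hx.1, hx.2, hx'⟩ y ⟨hy.1, hy.2, hy'⟩).mono ?_
  rintro z ⟨h1, h2, h3⟩
  exact ⟨⟨h1, h2⟩, M.cone_U0 i z ⟨h1, h2⟩ (ne_of_lt h3)⟩

theorem joined_VV (i) (x y : X) (hx : x ∈ M.VV i) (hy : y ∈ M.VV i) : JoinedIn (M.VV i) x y :=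
  (M.VV_sub_pathconn i (Cone M.ε) (convex_Cone _) ⟨_, M.star_mem_Cone⟩ subset_rfl).joinedIn
    x hx y hy

theorem exists_point (i) (o : ℂ) (ho : o ∈ Cone M.ε) : ∃ x ∈ M.VV i, M.om i x = o := by
  have ht : ((1 : ℂ), o * M.p i) ∈ M.e.target := by
    apply M.mem_target_of_cone i
    simpa [M.hp i] using ho
  have : M.om i (M.e.symm (1, o * M.p i)) = o := by
    unfold om
    rw [M.e.right_inv ht]
    simp [M.hp i]
  exact ⟨_, ⟨M.e.map_target ht, by rw [this]; exact ho⟩, this⟩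

end Model
end FGP
end

section
open Set Topology Filter unitInterval

namespace FGP
namespace Model

variable {X : Type} [TopologicalSpace X] {n m : ℕ} {α : Type} (M : Model X n m α)

/-- A functor to a group, trivial on the big piece. -/
structure Cl (G : Type) [Group G] where
  cl : ∀ x y : X, Path.Homotopic.Quotient x y → G
  tr : ∀ x y z (a : Path.Homotopic.Quotient x y) (b : Path.Homotopic.Quotient y z),
    cl x z (a.trans b) = cl y z b * cl x y a
  z0 : ∀ x y (γ : Path x y), (∀ t, γ t ∈ M.U0) → cl x y (.mk γ) = 1

variable {M} {G : Type} [Group G] (c : M.Cl G)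

namespace Cl

theorem refl (x) : c.cl x x (.mk (Path.refl x)) = 1 := by
  have := c.tr x x x (.refl x) (.refl x)
  rw [Path.Homotopic.Quotient.trans_refl] at this
  rw [Path.Homotopic.Quotient.mk_refl]
  simpa using this

theorem symm {x y} (γ : Path x y) : c.cl y x (.mk γ.symm) = (c.cl x y (.mk γ))⁻¹ := by
  have := c.tr x y x (.mk γ) (.mk γ.symm)
  rw [Path.Homotopic.Quotient.mk_symm, Path.Homotopic.Quotient.trans_symm,
    ← Path.Homotopic.Quotient.mk_refl, refl] at this
  rw [Path.Homotopic.Quotient.mk_symm]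
  exact eq_inv_of_mul_eq_one_left this.symm

theorem trans {x y z} (γ : Path x y) (δ : Path y z) :
    c.cl x z (.mk (γ.trans δ)) = c.cl y z (.mk δ) * c.cl x y (.mk γ) := by
  rw [Path.Homotopic.Quotient.mk_trans, c.tr]

theorem congr {x y} {γ δ : Path x y} (h : γ.Homotopic δ) :
    c.cl x y (.mk γ) = c.cl x y (.mk δ) := by
  rw [Path.Homotopic.Quotient.eq.2 h]

end Cl

theorem trans_mem {U : Set X} {x y z} (γ : Path x y) (δ : Path y z) (hγ : ∀ t, γ t ∈ U)
    (hδ : ∀ t, δ t ∈ U) : ∀ t, (γ.trans δ) t ∈ U := by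
  intro t
  have : (γ.trans δ) t ∈ range (γ.trans δ) := ⟨t, rfl⟩
  rw [Path.trans_range] at this
  rcases this with ⟨s, hs⟩ | ⟨s, hs⟩
  · rw [← hs]; exact hγ _
  · rw [← hs]; exact hδ _

theorem exists_T (i) : ∃ T : G, ∀ x y (γ : Path x y), (∀ t, γ t ∈ M.VV i) → 0 < (M.om i x).im →
    (M.om i y).im < 0 → c.cl x y (.mk γ) = T := by
  obtain ⟨x0, hx0, ex0⟩ := M.exists_point i _ M.star_mem_Cone
  obtain ⟨y0, hy0, ey0⟩ := M.exists_point i _ M.star_mem_Cone_neg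
  obtain ⟨γ0, hγ0⟩ := M.joined_VV i x0 y0 hx0 hy0
  refine ⟨c.cl x0 y0 (.mk γ0), ?_⟩
  intro x y γ hγ hx hy
  have hxV : x ∈ M.VV i := by simpa using hγ 0
  have hyV : y ∈ M.VV i := by simpa using hγ 1
  obtain ⟨a, ha⟩ := M.joined_pos i x x0 hxV hx0 hx (by rw [ex0]; exact M.hε)
  obtain ⟨b, hb⟩ := M.joined_neg i y0 y hy0 hyV (by rw [ey0]; exact neg_neg_of_pos M.hε) hy
  have h1 : γ.Homotopic ((a.trans γ0).trans b) := M.hnull_VV i _ _ _ _ hγ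
    (trans_mem _ _ (trans_mem _ _ (fun t => (ha t).1) hγ0) (fun t => (hb t).1))
  rw [c.congr h1, c.trans, c.trans, c.z0 _ _ a (fun t => (ha t).2), c.z0 _ _ b (fun t => (hb t).2)]
  simp

/-- The meridian class. -/
noncomputable def Cl.T (i : Fin (n + 1)) : G := (exists_T c i).choose

theorem Cl.T_spec (i) {x y} (γ : Path x y) (h : ∀ t, γ t ∈ M.VV i) (hx : 0 < (M.om i x).im)
    (hy : (M.om i y).im < 0) : c.cl x y (.mk γ) = c.T i :=
  (exists_T c i).choose_spec x y γ h hx hy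

theorem Cl.T_spec' (i) {x y} (γ : Path x y) (h : ∀ t, γ t ∈ M.VV i) (hx : (M.om i x).im < 0)
    (hy : 0 < (M.om i y).im) : c.cl x y (.mk γ) = (c.T i)⁻¹ := by
  rw [← c.T_spec i γ.symm (fun t => h _) hy hx, c.symm, inv_inv]

theorem Cl.VV_mem (S : Subgroup G) (hS : ∀ i, c.T i ∈ S) (i) {x y} (γ : Path x y)
    (h : ∀ t, γ t ∈ M.VV i) (hx : x ∈ M.U0) (hy : y ∈ M.U0) : c.cl x y (.mk γ) ∈ S := by
  have hxV : x ∈ M.VV i := by simpa using h 0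
  have hyV : y ∈ M.VV i := by simpa using h 1
  rcases lt_or_gt_of_ne (M.im_ne_zero i x hxV hx) with h1 | h1 <;>
  rcases lt_or_gt_of_ne (M.im_ne_zero i y hyV hy) with h2 | h2
  · obtain ⟨a, ha⟩ := M.joined_neg i x y hxV hyV h1 h2
    rw [c.congr (M.hnull_VV i _ _ _ _ h (fun t => (ha t).1)), c.z0 _ _ a (fun t => (ha t).2)]
    exact S.one_mem
  · rw [c.T_spec' i γ h h1 h2]
    exact S.inv_mem (hS i)
  · rw [c.T_spec i γ h h1 h2]
    exact hS i
  · obtain ⟨a, ha⟩ := M.joined_pos i x y hxV hyV h1 h2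
    rw [c.congr (M.hnull_VV i _ _ _ _ h (fun t => (ha t).1)), c.z0 _ _ a (fun t => (ha t).2)]
    exact S.one_mem

theorem Cl.source_mem (S : Subgroup G) (hS : ∀ i, c.T i ∈ S)
    (h1 : ∀ x, ∃ x' ∈ M.U0, ∃ γ : Path x' x, (x ∈ M.U0 → ∀ t, γ t ∈ M.U0) ∧
      (∀ i, x ∈ M.VV i → ∀ t, γ t ∈ M.VV i) ∧ c.cl x' x (.mk γ) = 1)
    {x y} (γ : Path x y) (h : ∀ t, γ t ∈ M.e.source) : c.cl x y (.mk γ) ∈ S := by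
  refine gen (ι := Option (Fin (n + 1))) (fun o => o.elim M.U0 M.VV) ?_
    (fun x y q => c.cl x y q ∈ S) ?_ ?_ x y γ ?_
  · rintro (_ | i)
    · exact M.isOpen_U0
    · exact M.isOpen_VV i
  · rintro (_ | i) x y γ hγ
    · rw [c.z0 _ _ γ hγ]; exact S.one_mem
    · change ∀ t, γ t ∈ M.VV i at hγ
      obtain ⟨x', hx', a, -, ha, ea⟩ := h1 x
      obtain ⟨y', hy', b, -, hb, eb⟩ := h1 y
      have := c.VV_mem S hS i ((a.trans γ).trans b.symm)
        (trans_mem _ _ (trans_mem _ _ (ha i (by simpa using hγ 0)) hγ)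
          (fun t => hb i (by simpa using hγ 1) _)) hx' hy'
      rw [c.trans, c.trans, c.symm, ea, eb] at this
      simpa using this
  · intro x y z a b ha hb
    change c.cl _ _ _ ∈ S
    rw [c.tr]
    exact S.mul_mem hb ha
  · intro t
    rcases M.source_cover _ (h t) with h | ⟨i, h⟩
    · exact ⟨none, h⟩
    · exact ⟨some i, h⟩

theorem om0_eq (a x) (hx : x ∈ M.Q a) (hs : x ∈ M.e.source) : M.om 0 x = 1 + M.w a x ^ m := by
  unfold om
  rw [M.hwd a x hx hs]
  field_simp [M.hp 0]

theorem om0_cone (a x) (hx : x ∈ M.Q a) (hs : x ∈ M.e.source) :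
    |(M.om 0 x).im| < M.ε * (M.om 0 x).re := by
  rw [om0_eq a x hx hs]
  have h1 := M.hwε a x hx
  have h2 := (Complex.abs_im_le_norm (M.w a x ^ m))
  have h3 := abs_le.1 (Complex.abs_re_le_norm (M.w a x ^ m))
  have := M.hε
  have := M.hε1
  simp only [Complex.add_im, Complex.one_im, Complex.add_re, Complex.one_re, zero_add]
  nlinarith

theorem Q_VV (a x) (hx : x ∈ M.Q a) (i) (h : x ∈ M.VV i) : i = 0 := by
  by_contra hi
  exact M.hcone 0 i (Ne.symm hi) _ (om0_cone a x hx h.1) h.2.2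

theorem Q_VV0 (a x) (hx : x ∈ M.Q a) : x ∈ M.VV 0 ↔ x ∈ M.e.source ∧ 0 < (M.w a x ^ m).re := by
  constructor
  · rintro ⟨h, h'⟩
    have := h'.1
    rw [om0_eq a x hx h] at this
    simp only [Complex.add_re, Complex.one_re] at this
    exact ⟨h, by linarith⟩
  · rintro ⟨h, h'⟩
    refine ⟨h, ?_, om0_cone a x hx h⟩
    rw [om0_eq a x hx h]
    simp only [Complex.add_re, Complex.one_re]
    linarith

theorem Q_U0 (a x) (hx : x ∈ M.Q a) : x ∈ M.U0 ↔ - M.w a x ^ m ∈ Complex.slitPlane := by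
  have hm := M.hm.ne'
  rw [Complex.mem_slitPlane_iff]
  simp only [Complex.neg_re, Complex.neg_im]
  constructor
  · rintro ⟨h, h'⟩
    have h1 := h' 0
    rw [om0_eq a x hx h] at h1
    by_contra hc
    push Not at hc
    apply h1
    constructor
    · simp; linarith [hc.1]
    · simp; linarith [hc.2]
  · intro hc
    have hw : M.w a x ≠ 0 := by
      intro h
      rw [h, zero_pow hm] at hc
      simp at hc
    have hs := (M.hwe a x hx).1 hw
    refine ⟨hs, ?_⟩
    intro i hi
    by_cases h0 : i = 0
    · subst h0
      rw [om0_eq a x hx hs] at hi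
      obtain ⟨h1, h2⟩ := hi
      simp at h1 h2
      rcases hc with hc | hc
      · linarith
      · exact hc (by simp [h2])
    · apply M.hcone 0 i (Ne.symm h0) _ (om0_cone a x hx hs)
      change |(M.om i x).im| < _ * (M.om i x).re
      rw [hi.2, abs_zero]
      have := M.hε
      have := hi.1
      positivity

end Model
end FGP
end

section
open Set Topology Filter unitInterval

namespace FGP
namespace Model

variable {X : Type} [TopologicalSpace X] {n m : ℕ} {α : Type} {M : Model X n m α}
variable {G : Type} [Group G] (c : M.Cl G)

theorem Cl.Q_loop (a) {x y} (hxy : x = y) (γ : Path x y) (h : ∀ t, γ t ∈ M.Q a) :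
    c.cl x y (.mk γ) = 1 := by
  subst hxy
  have hx : x ∈ M.Q a := by simpa using h 0
  rw [c.congr (M.hQnull a _ _ γ (Path.refl x) h (fun t => by simpa using hx)), c.refl]

/-- Reparametrised loop. -/
noncomputable def f (M : Model X n m α) (s : ℝ) : X := M.F (s / m)

theorem continuous_f : Continuous M.f := M.hF.comp (by fun_prop)

theorem f_Q (s) : M.f s ∈ M.Q M.a0 := M.hFQ _

theorem f_w (s : ℝ) : M.w M.a0 (M.f s) ^ m = ((M.ρ ^ m : ℝ) : ℂ) * Complex.exp (s * Complex.I) := by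
  have hm : (m : ℂ) ≠ 0 := by exact_mod_cast M.hm.ne'
  unfold f
  rw [M.hFw, mul_pow, ← Complex.exp_nat_mul]
  push_cast
  congr 2
  field_simp

theorem f_re (s : ℝ) : (M.w M.a0 (M.f s) ^ m).re = M.ρ ^ m * Real.cos s := by
  rw [f_w, Complex.re_ofReal_mul, Complex.exp_ofReal_mul_I_re]

theorem f_im (s : ℝ) : (M.w M.a0 (M.f s) ^ m).im = M.ρ ^ m * Real.sin s := by
  rw [f_w, Complex.im_ofReal_mul, Complex.exp_ofReal_mul_I_im]

theorem f_source (s : ℝ) : M.f s ∈ M.e.source := by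
  apply (M.hwe M.a0 _ (f_Q s)).1
  unfold f
  rw [M.hFw]
  have := M.hρ
  simp [this.ne']

theorem f_VV (s : ℝ) (h : 0 < Real.cos s) : M.f s ∈ M.VV 0 := by
  rw [Q_VV0 _ _ (f_Q s), f_re]
  have := M.hρ
  exact ⟨f_source s, by positivity⟩

theorem f_om (s : ℝ) : (M.om 0 (M.f s)).im = M.ρ ^ m * Real.sin s := by
  rw [om0_eq _ _ (f_Q s) (f_source s)]
  simp [f_im]

theorem f_U0 (s : ℝ) (h : Real.cos s < 0 ∨ Real.sin s ≠ 0) : M.f s ∈ M.U0 := by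
  rw [Q_U0 _ _ (f_Q s), Complex.mem_slitPlane_iff]
  simp only [Complex.neg_re, Complex.neg_im, f_re, f_im]
  have := M.hρ
  have h1 : 0 < M.ρ ^ m := by positivity
  rcases h with h | h
  · left; nlinarith
  · right
    simp [this.ne', h]

/-- The path along the loop. -/
noncomputable def L (M : Model X n m α) (a b : ℝ) : Path (M.f a) (M.f b) :=
  (Path.segment a b).map continuous_f

theorem L_mem {U : Set X} (a b : ℝ) (hab : a ≤ b) (h : ∀ s, a ≤ s → s ≤ b → M.f s ∈ U) :
    ∀ t, M.L a b t ∈ U := by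
  intro t
  have h1 : Path.segment a b t ∈ segment ℝ a b := by
    rw [← Path.range_segment]; exact ⟨t, rfl⟩
  rw [segment_eq_Icc hab] at h1
  exact h _ h1.1 h1.2

theorem Cl.L_trans (a b d : ℝ) : c.cl _ _ (.mk (M.L a d)) =
    c.cl _ _ (.mk (M.L b d)) * c.cl _ _ (.mk (M.L a b)) := by
  rw [← c.trans]
  apply c.congr
  unfold L
  rw [← Path.map_trans]
  exact Path.Homotopic.map (SimplyConnectedSpace.paths_homotopic _ _) ⟨M.f, continuous_f⟩

theorem Cl.L_step (k : ℕ) : c.cl _ _ (.mk (M.L (2 * Real.pi * k - Real.pi)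
    (2 * Real.pi * k + Real.pi))) = (c.T 0)⁻¹ := by
  have hpi := Real.pi_pos
  set K := 2 * Real.pi * k with hK
  have hcos : ∀ s, Real.cos s = Real.cos (s - K) := by
    intro s; rw [hK, show 2 * Real.pi * k = k * (2 * Real.pi) by ring, Real.cos_sub_nat_mul_two_pi]
  have hsin : ∀ s, Real.sin s = Real.sin (s - K) := by
    intro s; rw [hK, show 2 * Real.pi * k = k * (2 * Real.pi) by ring, Real.sin_sub_nat_mul_two_pi]
  have hr := M.hρ
  have hr' : 0 < M.ρ ^ m := by positivity
  rw [c.L_trans _ (K - Real.pi / 4), c.L_trans _ (K + Real.pi / 4) (K + Real.pi)]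
  have e1 : c.cl _ _ (.mk (M.L (K - Real.pi) (K - Real.pi / 4))) = 1 := by
    apply c.z0
    apply L_mem _ _ (by linarith)
    intro s h1 h2
    apply f_U0
    by_cases hs : s = K - Real.pi
    · left
      rw [hcos, hs]; simp
    · right
      have : K - Real.pi < s := lt_of_le_of_ne h1 (Ne.symm hs)
      rw [hsin]
      apply (Real.sin_neg_of_neg_of_neg_pi_lt (by linarith) (by linarith)).ne
  have e3 : c.cl _ _ (.mk (M.L (K + Real.pi / 4) (K + Real.pi))) = 1 := by
    apply c.z0
    apply L_mem _ _ (by linarith)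
    intro s h1 h2
    apply f_U0
    by_cases hs : s = K + Real.pi
    · left
      rw [hcos, hs]; simp
    · right
      have : s < K + Real.pi := lt_of_le_of_ne h2 hs
      rw [hsin]
      apply (Real.sin_pos_of_pos_of_lt_pi (by linarith) (by linarith)).ne'
  have e2 : c.cl _ _ (.mk (M.L (K - Real.pi / 4) (K + Real.pi / 4))) = (c.T 0)⁻¹ := by
    apply c.T_spec'
    · apply L_mem _ _ (by linarith)
      intro s h1 h2
      apply f_VV
      rw [hcos]
      exact Real.cos_pos_of_mem_Ioo ⟨by linarith, by linarith⟩
    · rw [f_om, hsin]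
      have := Real.sin_neg_of_neg_of_neg_pi_lt (x := K - Real.pi / 4 - K) (by linarith) (by linarith)
      nlinarith
    · rw [f_om, hsin]
      have := Real.sin_pos_of_pos_of_lt_pi (x := K + Real.pi / 4 - K) (by linarith) (by linarith)
      positivity
  rw [e1, e2, e3]
  simp

theorem Cl.L_pow (k : ℕ) : c.cl _ _ (.mk (M.L (- Real.pi) (2 * Real.pi * k - Real.pi))) =
    (c.T 0)⁻¹ ^ k := by
  induction k with
  | zero =>
    rw [pow_zero]
    apply c.Q_loop M.a0
    · simp
    · intro t; exact f_Q _
  | succ k ih =>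
    rw [c.L_trans _ (2 * Real.pi * k - Real.pi), ih]
    have := c.L_step k
    rw [show 2 * Real.pi * ((k + 1 : ℕ) : ℝ) - Real.pi = 2 * Real.pi * k + Real.pi by push_cast; ring,
      this, pow_succ']

theorem Cl.T_pow : c.T 0 ^ m = 1 := by
  have h := c.L_pow m
  rw [c.Q_loop M.a0] at h
  · rw [inv_pow] at h
    exact inv_eq_one.1 h.symm
  · have hm : (m : ℝ) ≠ 0 := by exact_mod_cast M.hm.ne'
    unfold f
    rw [show (2 * Real.pi * m - Real.pi) / m = -Real.pi / m + 2 * Real.pi by field_simp; ring, M.hFper]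
  · intro t; exact f_Q _

end Model
end FGP
end

section
open Set Topology Filter unitInterval

namespace FGP

theorem eventually_const_of_pow_eq_one {X : Type*} [TopologicalSpace X] (m : ℕ) (hm : 0 < m)
    (φ : X → ℂ) (x : X) (h : ContinuousAt φ x) (h1 : ∀ᶠ x' in 𝓝 x, φ x' ^ m = 1) :
    ∀ᶠ x' in 𝓝 x, φ x' = φ x := by
  have hfin : {z : ℂ | z ^ m = 1}.Finite := by
    have := (Polynomial.nthRoots m (1 : ℂ)).toFinset.finite_toSet
    refine this.subset ?_
    intro z hz
    simpa [Polynomial.mem_nthRoots hm] using hz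
  have h2 : ({z : ℂ | z ^ m = 1} \ {φ x})ᶜ ∈ 𝓝 (φ x) :=
    (hfin.subset sdiff_subset).isClosed.isOpen_compl.mem_nhds (by simp)
  filter_upwards [h.eventually_mem h2, h1] with x' h3 h4
  by_contra hc
  exact h3 ⟨h4, hc⟩

/-- The primitive root. -/
noncomputable def zet (m : ℕ) : ℂ := Complex.exp (2 * Real.pi * Complex.I / m)

theorem zet_prim (m : ℕ) (hm : 0 < m) : IsPrimitiveRoot (zet m) m :=
  Complex.isPrimitiveRoot_exp m hm.ne'

theorem exists_chi {O : Type*} [Group O] (m : ℕ) (hm : 0 < m) (g : O) (hg : g ^ m = 1) :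
    ∃ χ : ℂ → O, (∀ r s, r ^ m = 1 → s ^ m = 1 → χ (r * s) = χ r * χ s) ∧ χ (zet m)⁻¹ = g := by
  classical
  have hz := zet_prim m hm
  have hz0 : zet m ≠ 0 := hz.ne_zero hm.ne'
  have : NeZero m := ⟨hm.ne'⟩
  have hex : ∀ r : ℂ, r ^ m = 1 → ∃ k : ℕ, r * zet m ^ k = 1 := by
    intro r hr
    have hr0 : r ≠ 0 := by rintro rfl; simp [hm.ne'] at hr
    obtain ⟨k, -, hk⟩ := hz.eq_pow_of_pow_eq_one (ξ := r⁻¹) (by rw [inv_pow, hr, inv_one])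
    exact ⟨k, by rw [hk, mul_inv_cancel₀ hr0]⟩
  let χ : ℂ → O := fun r => if h : ∃ k : ℕ, r * zet m ^ k = 1 then g ^ h.choose else 1
  have key : ∀ r (k : ℕ), r * zet m ^ k = 1 → χ r = g ^ k := by
    intro r k hk
    have h : ∃ k : ℕ, r * zet m ^ k = 1 := ⟨k, hk⟩
    simp only [χ, dif_pos h]
    have h2 := h.choose_spec
    set l := h.choose
    have hr0 : r ≠ 0 := by rintro rfl; simp at hk
    have h3 : zet m ^ l = zet m ^ k := mul_left_cancel₀ hr0 (h2.trans hk.symm)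
    rw [pow_eq_pow_iff_modEq]
    rw [(hz.isUnit hm.ne').unit_spec.symm] at h3
    have h4 := pow_eq_pow_iff_modEq.1 (Units.ext (by simpa using h3) :
      (hz.isUnit hm.ne').unit ^ l = (hz.isUnit hm.ne').unit ^ k)
    rw [← orderOf_units, (hz.isUnit hm.ne').unit_spec, ← hz.eq_orderOf] at h4
    exact h4.of_dvd (orderOf_dvd_of_pow_eq_one hg)
  refine ⟨χ, ?_, ?_⟩
  · intro r s hr hs
    obtain ⟨k, hk⟩ := hex r hr
    obtain ⟨l, hl⟩ := hex s hs
    rw [key r k hk, key s l hl, key (r * s) (k + l), pow_add]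
    rw [pow_add]
    linear_combination (s * zet m ^ l) * hk + hl
  · rw [key _ 1 (by field_simp), pow_one]

/-- The branch of the root with cut along the positive reals. -/
noncomputable def rt (m : ℕ) (u : ℂ) : ℂ :=
  (-u) ^ ((1 : ℂ) / m) * Complex.exp (Real.pi * Complex.I / m)

theorem cpow_inv_pow (m : ℕ) (hm : 0 < m) (u : ℂ) : (u ^ ((1 : ℂ) / m)) ^ m = u := by
  rw [one_div, Complex.cpow_nat_inv_pow u hm.ne']

theorem rt_pow (m : ℕ) (hm : 0 < m) (u : ℂ) : rt m u ^ m = u := by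
  have : (m : ℂ) ≠ 0 := by exact_mod_cast hm.ne'
  rw [rt, mul_pow, cpow_inv_pow m hm, ← Complex.exp_nat_mul, mul_div_cancel₀ _ this,
    Complex.exp_pi_mul_I]
  ring

theorem rt_of_re_pos (m : ℕ) (hm : 0 < m) (u : ℂ) (hu : 0 < u.re) :
    rt m u = u ^ ((1 : ℂ) / m) * (if 0 < u.im then 1 else zet m) := by
  have hmc : (m : ℂ) ≠ 0 := by exact_mod_cast hm.ne'
  have hu0 : u ≠ 0 := by rintro rfl; simp at hu
  have hl : Complex.log (-u) = Complex.log u + (if 0 < u.im then -1 else 1) * (Real.pi * Complex.I) := by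
    apply Complex.ext
    · simp only [Complex.log_re, norm_neg, Complex.add_re]
      split_ifs <;> simp
    · simp only [Complex.log_im, Complex.add_im]
      split_ifs with h
      · rw [Complex.arg_neg_eq_arg_sub_pi_of_im_pos h]; simp; ring
      · rcases (not_lt.1 h).lt_or_eq with h | h
        · rw [Complex.arg_neg_eq_arg_add_pi_of_im_neg h]; simp
        · have : u = (u.re : ℂ) := Complex.ext rfl (by simpa using h)
          rw [this, ← Complex.ofReal_neg, Complex.arg_ofReal_of_neg (by linarith),
            Complex.arg_ofReal_of_nonneg hu.le]
          simp
  rw [rt, Complex.cpow_def_of_ne_zero (neg_ne_zero.2 hu0), Complex.cpow_def_of_ne_zero hu0, hl]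
  split_ifs
  · rw [← Complex.exp_add, mul_one]
    congr 1
    field_simp
    ring
  · rw [zet, ← Complex.exp_add, ← Complex.exp_add]
    congr 1
    field_simp
    ring

theorem rt_continuousAt (m : ℕ) (u : ℂ) (hu : -u ∈ Complex.slitPlane) :
    ContinuousAt (rt m) u := by
  unfold rt
  apply ContinuousAt.mul _ (by fun_prop)
  exact ContinuousAt.cpow (by fun_prop) (by fun_prop) hu

namespace Model
variable {X : Type} [TopologicalSpace X] {n m : ℕ} {α : Type} (M : Model X n m α)

/-- Locally constant ratio. -/
def LC {O : Type} [Group O] (f g : X → O) (x : X) : Prop :=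
  ∀ᶠ x' in 𝓝 x, (g x')⁻¹ * f x' = (g x)⁻¹ * f x

theorem LC.symm {O : Type} [Group O] {f g : X → O} {x : X} (h : LC f g x) : LC g f x := by
  filter_upwards [h] with x' hx
  have := congrArg (·⁻¹) hx
  simpa using this

open Classical in
/-- The root of unity attached to a chart. -/
noncomputable def rr (a : α) (x : X) : ℂ :=
  if M.w a x = 0 then M.E a x else M.w a x / rt m (M.w a x ^ m)

theorem rr_pow (a : α) (x : X) : M.rr a x ^ m = 1 := by
  unfold rr
  split_ifs with h
  · exact M.hE1 a x
  · rw [div_pow, rt_pow m M.hm, div_self (pow_ne_zero _ h)]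

variable {O : Type} [Group O]

open Classical in
/-- The cocycle functions. -/
noncomputable def hfun (χ : ℂ → O) (g : Fin (n + 1) → O) : Option (Fin (n + 1) ⊕ α) → X → O
  | none => fun _ => 1
  | some (.inl i) => fun x => if 0 < (M.om i x).im then 1 else g i
  | some (.inr a) => fun x => χ (M.rr a x)

/-- The cover. -/
def UU : Option (Fin (n + 1) ⊕ α) → Set X
  | none => M.U0
  | some (.inl i) => M.VV i
  | some (.inr a) => M.Q a

theorem hfun_LC (χ : ℂ → O) (g : Fin (n + 1) → O)
    (hχ : ∀ r s, r ^ m = 1 → s ^ m = 1 → χ (r * s) = χ r * χ s) (hχ0 : χ (zet m)⁻¹ = g 0) :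
    ∀ j k x, x ∈ M.UU j → x ∈ M.UU k → LC (M.hfun χ g j) (M.hfun χ g k) x := by
  have hm := M.hm
  have hzv : ∀ i x, x ∈ M.U0 → x ∈ M.VV i →
      LC (M.hfun χ g none) (M.hfun χ g (some (.inl i))) x := by
    intro i x h0 hi
    have him := M.im_ne_zero i x hi h0
    have hc : ContinuousAt (fun x => (M.om i x).im) x := Complex.continuous_im.continuousAt.comp
      ((M.continuousOn_om i).continuousAt (M.e.open_source.mem_nhds hi.1))
    simp only [LC, hfun]
    rcases lt_or_gt_of_ne him with h | h
    · filter_upwards [hc.eventually_lt_const h] with x' hx'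
      rw [if_neg (not_lt.2 hx'.le), if_neg (not_lt.2 h.le)]
    · filter_upwards [hc.eventually_const_lt h] with x' hx'
      rw [if_pos hx', if_pos h]
  have hzq : ∀ a x, x ∈ M.U0 → x ∈ M.Q a →
      LC (M.hfun χ g (some (.inr a))) (M.hfun χ g none) x := by
    intro a x h0 ha
    have hs := (Q_U0 a x ha).1 h0
    have hw0 := (M.hwe a x ha).2 h0.1
    have hwc : ContinuousAt (M.w a) x := (M.hw a).continuousAt ((M.hQ a).mem_nhds ha)
    have hc : ContinuousAt (fun x => M.w a x / rt m (M.w a x ^ m)) x := by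
      apply hwc.div
      · exact ContinuousAt.comp (g := rt m) (rt_continuousAt m _ hs) (hwc.pow m)
      · intro h
        have := rt_pow m hm (M.w a x ^ m)
        rw [h, zero_pow hm.ne'] at this
        exact hw0 (pow_eq_zero_iff hm.ne' |>.1 this.symm)
    have hne : ∀ᶠ x' in 𝓝 x, M.w a x' ≠ 0 := hwc.eventually_ne hw0
    have h3 := eventually_const_of_pow_eq_one m hm _ x hc (by
      filter_upwards [hne] with x' hx'
      rw [div_pow, rt_pow m M.hm, div_self (pow_ne_zero _ hx')])
    simp only [LC, hfun]
    filter_upwards [hne, h3] with x' h4 h5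
    unfold rr
    rw [if_neg h4, if_neg hw0, h5]
  have hvv : ∀ i j x, x ∈ M.VV i → x ∈ M.VV j →
      LC (M.hfun χ g (some (.inl i))) (M.hfun χ g (some (.inl j))) x := by
    intro i j x hi hj
    by_cases hij : i = j
    · subst hij
      simp [LC]
    · exact absurd hj.2.2 (M.hcone i j hij _ hi.2.2)
  have hvq : ∀ i a x, x ∈ M.VV i → x ∈ M.Q a →
      LC (M.hfun χ g (some (.inr a))) (M.hfun χ g (some (.inl i))) x := by
    intro i a x hi ha
    obtain rfl := Q_VV a x ha i hi
    have hwc : ContinuousAt (M.w a) x := (M.hw a).continuousAt ((M.hQ a).mem_nhds ha)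
    have hre := ((Q_VV0 a x ha).1 hi).2
    have hw0 := (M.hwe a x ha).2 hi.1
    have hc : ContinuousAt (fun x => M.w a x / (M.w a x ^ m) ^ ((1 : ℂ) / m)) x := by
      apply hwc.div
      · exact ContinuousAt.cpow (hwc.pow m) (by fun_prop) (Or.inl hre)
      · intro h
        have := cpow_inv_pow m hm (M.w a x ^ m)
        rw [h, zero_pow hm.ne'] at this
        exact hw0 (pow_eq_zero_iff hm.ne' |>.1 this.symm)
    have hne : ∀ᶠ x' in 𝓝 x, M.w a x' ≠ 0 := hwc.eventually_ne hw0
    have h3 := eventually_const_of_pow_eq_one m hm _ x hc (by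
      filter_upwards [hne] with x' hx'
      rw [div_pow, cpow_inv_pow m M.hm, div_self (pow_ne_zero _ hx')])
    have key : ∀ x', x' ∈ M.VV 0 → x' ∈ M.Q a →
        (M.hfun χ g (some (.inl 0)) x')⁻¹ * M.hfun χ g (some (.inr a)) x' =
          χ (M.w a x' / (M.w a x' ^ m) ^ ((1 : ℂ) / m)) := by
      intro x' h1 h2
      have hre := ((Q_VV0 a x' h2).1 h1).2
      have hw0 := (M.hwe a x' h2).2 h1.1
      simp only [hfun, rr]
      rw [if_neg hw0, rt_of_re_pos m hm _ hre, om0_eq a x' h2 h1.1]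
      simp only [Complex.add_im, Complex.one_im, zero_add]
      split_ifs
      · simp
      · rw [← div_div, div_eq_mul_inv _ (zet m), mul_comm _ (zet m)⁻¹, hχ _ _, hχ0]
        · group
        · rw [inv_pow, (zet_prim m hm).pow_eq_one, inv_one]
        · rw [div_pow, cpow_inv_pow m M.hm, div_self (pow_ne_zero _ hw0)]
    unfold LC
    filter_upwards [(M.isOpen_VV 0).mem_nhds hi, (M.hQ a).mem_nhds ha, h3] with x' h4 h5 h6
    rw [key x hi ha, key x' h4 h5, h6]
  have hqq : ∀ a b x, x ∈ M.Q a → x ∈ M.Q b →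
      LC (M.hfun χ g (some (.inr a))) (M.hfun χ g (some (.inr b))) x := by
    intro a b x ha hb
    obtain ⟨ζ, hζ, hev⟩ := M.hE a b x ha hb
    have hζ0 : ζ ≠ 0 := by rintro rfl; simp [hm.ne'] at hζ
    have key : ∀ᶠ x' in 𝓝 x, (M.hfun χ g (some (.inr b)) x')⁻¹ * M.hfun χ g (some (.inr a)) x' =
        χ ζ := by
      filter_upwards [hev] with x' ⟨h1, h2⟩
      have : M.rr a x' = M.rr b x' * ζ := by
        unfold rr
        by_cases h : M.w b x' = 0
        · rw [if_pos h, if_pos (by rw [h1, h, mul_zero]), h2, mul_comm]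
        · rw [if_neg h, if_neg (by rw [h1]; exact mul_ne_zero hζ0 h), h1, mul_pow, hζ, one_mul]
          ring
      simp only [hfun]
      rw [this, hχ _ _ (M.rr_pow b x') hζ]
      group
    unfold LC
    filter_upwards [key] with x' h
    rw [h, key.self_of_nhds]
  rintro (_ | i | a) (_ | j | b) x hj hk
  · simp [LC]
  · exact hzv _ _ hj hk
  · exact (hzq _ _ hj hk).symm
  · exact (hzv _ _ hk hj).symm
  · exact hvv _ _ _ hj hk
  · exact (hvq _ _ _ hj hk).symm
  · exact hzq _ _ hk hj
  · exact hvq _ _ _ hk hj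
  · exact hqq _ _ _ hj hk

theorem model_pi1 (M : Model X n m α) [LocallyPathConnectedSpace X] [Finite α] (g : Fin (n + 1) → O)
    (hg : Subgroup.closure (range g) = ⊤) (hg0 : g 0 ^ m = 1)
    (huniv : ∀ (G : Type) [Group G] (T : Fin (n + 1) → G), T 0 ^ m = 1 →
      ∃ Φ : O →* G, ∀ i, Φ (g i) = T i) :
    ∀ x : X, Nonempty (FundamentalGroup X x ≃* O) := by
  obtain ⟨χ, hχ, hχ0⟩ := exists_chi m M.hm (g 0) hg0
  obtain ⟨x0, hx0⟩ := M.pathconn_U0.nonempty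
  refine abstract_pi1 M.UU ?_ ?_ none (M.hfun χ g) (M.hfun_LC χ g hχ hχ0) (fun _ => rfl)
    M.dense_U0 M.pathconn_U0 ?_ x0 hx0 ?_
  · rintro (_ | i | a)
    · exact M.isOpen_U0
    · exact M.isOpen_VV i
    · exact M.hQ a
  · intro x
    by_cases hs : x ∈ M.e.source
    · rcases M.source_cover x hs with h | ⟨i, h⟩
      · exact ⟨none, h⟩
      · exact ⟨some (.inl i), h⟩
    · obtain ⟨a, ha⟩ := M.hcov x hs
      exact ⟨some (.inr a), ha⟩
  · rintro (_ | i | a)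
    · exact M.hnull_U0
    · exact M.hnull_VV i
    · exact M.hQnull a
  · intro cl hclt hcl0 hcl1
    let c : M.Cl (FundamentalGroup X x0) := ⟨cl, hclt, hcl0⟩
    obtain ⟨Φ, hΦ⟩ := huniv (FundamentalGroup X x0) c.T c.T_pow
    have hT : ∀ i, c.T i ∈ Φ.range := fun i => ⟨g i, hΦ i⟩
    refine ⟨Φ, ?_, range g, hg, ?_⟩
    · rintro (_ | i | a) x y hx hx0 hy hy0
      · obtain ⟨γ, hγ⟩ := M.pathconn_U0.joinedIn x hx y hy
        refine ⟨γ, hγ, ?_⟩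
        rw [hcl0 _ _ γ hγ]
        exact Φ.range.one_mem
      · obtain ⟨γ, hγ⟩ := M.joined_VV i x y hx hy
        exact ⟨γ, hγ, c.VV_mem _ hT i γ hγ hx0 hy0⟩
      · obtain ⟨γ, hγ⟩ := M.hQconn a x y hx hx0.1 hy hy0.1
        refine ⟨γ, fun t => (hγ t).1, c.source_mem _ hT ?_ γ (fun t => (hγ t).2)⟩
        intro x
        obtain ⟨x', hx', γ, h1, h2⟩ := hcl1 x
        exact ⟨x', hx', γ, h1 none, fun i => h1 (some (.inl i)), h2⟩
    · rintro _ ⟨i, rfl⟩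
      obtain ⟨x, hx, ex⟩ := M.exists_point i _ M.star_mem_Cone
      obtain ⟨y, hy, ey⟩ := M.exists_point i _ M.star_mem_Cone_neg
      have hε := M.hε
      have hxi : 0 < (M.om i x).im := by rw [ex]; exact hε
      have hyi : (M.om i y).im < 0 := by rw [ey]; exact neg_neg_of_pos hε
      obtain ⟨γ, hγ⟩ := M.joined_VV i x y hx hy
      refine ⟨some (.inl i), x, y, γ, M.cone_U0 i x hx hxi.ne', M.cone_U0 i y hy hyi.ne, hγ, ?_, ?_⟩
      · rw [hΦ]
        exact c.T_spec i γ hγ hxi hyi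
      · simp only [hfun]
        rw [if_pos hxi, if_neg (not_lt.2 hyi.le)]
        simp

end Model
end FGP
end

section
open Set Topology Filter unitInterval

namespace FGP

theorem countable_exp (Δ : ℝ) (hΔ : Δ ≠ 0) (c0 : ℂ) :
    {κ : ℝ | Complex.exp ((κ * Δ : ℝ) * Complex.I) = c0}.Countable := by
  by_cases h : ∃ κ0 : ℝ, Complex.exp ((κ0 * Δ : ℝ) * Complex.I) = c0
  · obtain ⟨κ0, h0⟩ := h
    refine (countable_range (fun k : ℤ => κ0 + k * (2 * Real.pi) / Δ)).mono ?_
    intro κ hκ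
    have hκ' : Complex.exp ((κ * Δ : ℝ) * Complex.I) = c0 := hκ
    rw [← h0, Complex.exp_eq_exp_iff_exists_int] at hκ'
    obtain ⟨k, hk⟩ := hκ'
    refine ⟨k, ?_⟩
    have h1 := congrArg Complex.im hk
    simp at h1
    simp only
    field_simp
    linarith
  · convert countable_empty
    ext κ
    simp only [mem_ofPred_eq, mem_empty_iff_false, iff_false]
    exact fun hκ => h ⟨κ, hκ⟩

theorem g_lt (a η x y : ℝ) (hη : 0 < η) (hx : x = a ∨ η < |x - a|) (hy : y = a ∨ η < |y - a|)
    (h : x < y) : max (x - a - η) 0 + min (x - a + η) 0 < max (y - a - η) 0 + min (y - a + η) 0 := by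
  rcases max_cases (x - a - η) 0 with ⟨e1, f1⟩ | ⟨e1, f1⟩ <;>
  rcases max_cases (y - a - η) 0 with ⟨e2, f2⟩ | ⟨e2, f2⟩ <;>
  rcases min_cases (x - a + η) 0 with ⟨e3, f3⟩ | ⟨e3, f3⟩ <;>
  rcases min_cases (y - a + η) 0 with ⟨e4, f4⟩ | ⟨e4, f4⟩ <;>
  rw [e1, e2, e3, e4] <;>
  rcases hx with hx | hx <;> rcases hy with hy | hy <;>
  first
  | linarith
  | (rcases lt_abs.1 hx with hx | hx <;> rcases lt_abs.1 hy with hy | hy <;> linarith)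
  | (rcases lt_abs.1 hx with hx | hx <;> linarith)
  | (rcases lt_abs.1 hy with hy | hy <;> linarith)

theorem exists_twist {n : ℕ} (d : Fin (n + 1) → ℂ) (hd0 : ∀ i, d i ≠ 0)
    (hinj : Function.Injective d) : ∃ φ : ℝ → ℝ, Continuous φ ∧ ∃ η > 0,
      (∀ r, |r - ‖d 0‖| ≤ η → φ r = 0) ∧ ∀ i j, i ≠ j → ∀ t : ℝ, 0 < t →
        d i * Complex.exp (φ ‖d i‖ * Complex.I) ≠ t * (d j * Complex.exp (φ ‖d j‖ * Complex.I)) := by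
  obtain ⟨η, hη, hη0⟩ : ∃ η : ℝ, 0 < η ∧ ∀ i, ‖d i‖ = ‖d 0‖ ∨ η < |‖d i‖ - ‖d 0‖| := by
    have h1 : ∀ᶠ η in 𝓝[>] (0 : ℝ), ∀ i, ‖d i‖ = ‖d 0‖ ∨ η < |‖d i‖ - ‖d 0‖| := by
      rw [eventually_all]
      intro i
      by_cases h : ‖d i‖ = ‖d 0‖
      · simp [h]
      · have : 0 < |‖d i‖ - ‖d 0‖| := abs_pos.2 (sub_ne_zero.2 h)
        filter_upwards [Ioo_mem_nhdsGT this] with η hη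
        exact Or.inr hη.2
    obtain ⟨η, h2, h3⟩ := (h1.and self_mem_nhdsWithin).exists
    exact ⟨η, h3, h2⟩
  let g : ℝ → ℝ := fun x => max (x - ‖d 0‖ - η) 0 + min (x - ‖d 0‖ + η) 0
  have hg : ∀ i j, ‖d i‖ ≠ ‖d j‖ → g ‖d i‖ - g ‖d j‖ ≠ 0 := by
    intro i j hij
    rw [sub_ne_zero]
    rcases lt_or_gt_of_ne hij with h | h
    · exact (g_lt _ _ _ _ hη (hη0 i) (hη0 j) h).ne
    · exact (g_lt _ _ _ _ hη (hη0 j) (hη0 i) h).ne'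
  let B : Fin (n + 1) × Fin (n + 1) → Set ℝ := fun q =>
    {κ | ‖d q.1‖ ≠ ‖d q.2‖ ∧ Complex.exp ((κ * (g ‖d q.1‖ - g ‖d q.2‖) : ℝ) * Complex.I) =
      (‖d q.1‖ / ‖d q.2‖ : ℝ) * d q.2 / d q.1}
  have hB : ∀ q, (B q).Countable := by
    intro q
    by_cases h : ‖d q.1‖ = ‖d q.2‖
    · convert countable_empty
      ext κ; simp [B, h]
    · exact (countable_exp _ (hg _ _ h) _).mono fun κ hκ => hκ.2
  have hU : (⋃ q, B q).Countable := countable_iUnion hB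
  obtain ⟨κ, hκ⟩ : ∃ κ, κ ∉ ⋃ q, B q := by
    by_contra hc
    push Not at hc
    have : (⋃ q, B q) = univ := eq_univ_of_forall hc
    rw [this] at hU
    exact not_countable_univ hU
  refine ⟨fun r => κ * g r, by fun_prop, η, hη, ?_, ?_⟩
  · intro r hr
    have h1 := abs_le.1 hr
    simp only [g]
    rw [max_eq_right (by linarith [h1.2]), min_eq_right (by linarith [h1.1])]
    simp
  · intro i j hij t ht h
    have hn := congrArg norm h
    simp only [norm_mul, Complex.norm_exp_ofReal_mul_I, mul_one, Complex.norm_real,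
      Real.norm_eq_abs, abs_of_pos ht] at hn
    by_cases hne : ‖d i‖ = ‖d j‖
    · have ht1 : t = 1 := by
        rw [hne] at hn
        have : ‖d j‖ ≠ 0 := norm_ne_zero_iff.2 (hd0 j)
        field_simp at hn
        linarith
      apply hij
      apply hinj
      rw [hne, ht1, Complex.ofReal_one, one_mul] at h
      exact mul_right_cancel₀ (Complex.exp_ne_zero _) h
    · apply hκ
      rw [mem_iUnion]
      refine ⟨(i, j), hne, ?_⟩
      have h1 : ‖d j‖ ≠ 0 := norm_ne_zero_iff.2 (hd0 j)
      have h2 : ‖d i‖ / ‖d j‖ = t := by rw [hn]; field_simp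
      simp only
      rw [h2, eq_div_iff (hd0 i), mul_sub, Complex.ofReal_sub, sub_mul, Complex.exp_sub,
        div_mul_eq_mul_div, div_eq_iff (Complex.exp_ne_zero _)]
      rw [mul_comm _ (d i), h]
      ring

theorem cone_pair (c : ℂ) (hc : ∀ t : ℝ, 0 ≤ t → c ≠ t) : ∃ ε0 > 0, ∀ ε, 0 < ε → ε < ε0 →
    ∀ z : ℂ, |z.im| < ε * z.re → ¬ |(c * z).im| < ε * (c * z).re := by
  obtain ⟨a, b⟩ := c
  by_cases hb : b = 0
  · subst hb
    refine ⟨1, one_pos, ?_⟩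
    rintro ε hε - ⟨x, y⟩ h1 h2
    simp only [Complex.mul_im, Complex.mul_re, zero_mul, add_zero, sub_zero] at h1 h2
    have hx : 0 < x := by
      have := (abs_nonneg y).trans_lt h1
      exact pos_of_mul_pos_right this hε.le
    have ha : a < 0 := by
      by_contra hc'
      exact hc a (not_lt.1 hc') (Complex.ext rfl rfl)
    have := (abs_nonneg _).trans_lt h2
    have h3 : a * x < 0 := mul_neg_of_neg_of_pos ha hx
    nlinarith
  · have hb' : 0 < |b| := abs_pos.2 hb
    refine ⟨min (1/2) (|b| / (4 * (|a| + |b|))), by positivity, ?_⟩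
    rintro ε hε hε0 ⟨x, y⟩ h1 h2
    simp only [Complex.mul_im, Complex.mul_re] at h1 h2
    have hx : 0 < x := by
      have := (abs_nonneg y).trans_lt h1
      exact pos_of_mul_pos_right this hε.le
    have e1 : ε < 1/2 := hε0.trans_le (min_le_left _ _)
    have e2 : ε < |b| / (4 * (|a| + |b|)) := hε0.trans_le (min_le_right _ _)
    rw [lt_div_iff₀ (by positivity)] at e2
    have h3 : |b| * x ≤ |a * y + b * x| + |a| * |y| := by
      rw [← abs_mul, ← abs_of_pos hx, ← abs_mul, abs_of_pos hx]
      calc |b * x| = |(a * y + b * x) - a * y| := by ring_nf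
        _ ≤ _ := abs_sub _ _
    have h4 : a * x ≤ |a| * x := by gcongr; exact le_abs_self a
    have h5 : - (b * y) ≤ |b| * |y| := by rw [← abs_mul]; exact neg_le_abs _
    have h6 : |a| * |y| ≤ |a| * (ε * x) := by gcongr
    have h7 : |b| * |y| ≤ |b| * (ε * x) := by gcongr
    have h8 : |b| * x < ε * (|a| * x + |b| * (ε * x)) + |a| * (ε * x) := by nlinarith
    have h9 : |b| < ε * (|a| + |b| * ε) + |a| * ε := by
      have : |b| * x < (ε * (|a| + |b| * ε) + |a| * ε) * x := by linarith
      exact lt_of_mul_lt_mul_right this hx.le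
    have ha := abs_nonneg a
    nlinarith [mul_pos hε hb']

theorem exists_cone {n : ℕ} (p : Fin (n + 1) → ℂ) (hp : ∀ i, p i ≠ 0)
    (h : ∀ i j, i ≠ j → ∀ t : ℝ, 0 < t → p i ≠ t * p j) : ∃ ε : ℝ, 0 < ε ∧ ε ≤ 1 ∧
      ∀ i j, i ≠ j → ∀ d : ℂ, |(d / p i).im| < ε * (d / p i).re →
        ¬ |(d / p j).im| < ε * (d / p j).re := by
  have h1 : ∀ᶠ ε in 𝓝[>] (0 : ℝ), ∀ i j, i ≠ j → ∀ d : ℂ, |(d / p i).im| < ε * (d / p i).re →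
        ¬ |(d / p j).im| < ε * (d / p j).re := by
    rw [eventually_all]
    intro i
    rw [eventually_all]
    intro j
    by_cases hij : i = j
    · simp [hij]
    obtain ⟨ε0, h0, h1⟩ := cone_pair (p i / p j) (by
      intro t ht he
      rw [div_eq_iff (hp j)] at he
      rcases ht.lt_or_eq with ht | ht
      · exact h i j hij t ht he
      · subst ht
        exact hp i (by simpa using he))
    filter_upwards [Ioo_mem_nhdsGT h0] with ε hε _ d hd
    have := h1 ε hε.1 hε.2 (d / p i) hd
    rwa [show p i / p j * (d / p i) = d / p j by field_simp [hp i]] at this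
  obtain ⟨ε, h2, h3⟩ := (h1.and (Ioo_mem_nhdsGT one_pos)).exists
  exact ⟨ε, h3.1, h3.2.le, h2⟩

/-- The twisting homeomorphism. -/
noncomputable def twist (φ : ℝ → ℝ) (hφ : Continuous φ) : ℂ × ℂ ≃ₜ ℂ × ℂ where
  toFun q := (q.1, q.2 * Complex.exp (φ ‖q.1 * q.2‖ * Complex.I))
  invFun q := (q.1, q.2 * Complex.exp (-φ ‖q.1 * q.2‖ * Complex.I))
  left_inv q := by
    simp only [← mul_assoc, norm_mul, Complex.norm_exp_ofReal_mul_I, mul_one]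
    rw [mul_assoc, ← Complex.exp_add, neg_mul, add_neg_cancel]
    simp
  right_inv q := by
    have : ‖Complex.exp (-φ ‖q.1 * q.2‖ * Complex.I)‖ = 1 := by
      rw [← Complex.ofReal_neg, Complex.norm_exp_ofReal_mul_I]
    simp only [← mul_assoc]
    rw [norm_mul (q.1 * q.2), this, mul_one, mul_assoc, ← Complex.exp_add, neg_mul, neg_add_cancel]
    simp
  continuous_toFun := by fun_prop
  continuous_invFun := by fun_prop

theorem twist_prod (φ : ℝ → ℝ) (hφ : Continuous φ) (q : ℂ × ℂ) : (twist φ hφ q).1 * (twist φ hφ q).2 =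
    q.1 * q.2 * Complex.exp (φ ‖q.1 * q.2‖ * Complex.I) := by
  simp only [twist, Homeomorph.homeomorph_mk_coe, Equiv.coe_fn_mk]
  ring

theorem tw_inj (φ : ℝ → ℝ) (a b : ℂ) (h : a * Complex.exp (φ ‖a‖ * Complex.I) =
    b * Complex.exp (φ ‖b‖ * Complex.I)) : a = b := by
  have hn := congrArg norm h
  simp only [norm_mul, Complex.norm_exp_ofReal_mul_I, mul_one] at hn
  rw [hn] at h
  exact mul_right_cancel₀ (Complex.exp_ne_zero _) h

end FGP
end

section
open Set Topology Filter unitInterval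

namespace FGP

/-- Charts near the orbifold locus. -/
structure Pre (X : Type) [TopologicalSpace X] (m : ℕ) (α : Type) (d0 : ℂ)
    (e : OpenPartialHomeomorph X (ℂ × ℂ)) (ε : ℝ) where
  k : α → OpenPartialHomeomorph X (ℂ × ℂ)
  hcov : ∀ x, x ∉ e.source → ∃ a, x ∈ (k a).source
  hstar : ∀ a, StarConvex ℝ 0 (k a).target
  h0 : ∀ a, 0 ∈ (k a).target
  hconn : ∀ a, IsPathConnected ((k a).target ∩ {q | q.2 ≠ 0})
  hke : ∀ a x, x ∈ (k a).source → ((k a x).2 ≠ 0 ↔ x ∈ e.source)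
  hkd : ∀ a x, x ∈ (k a).source → x ∈ e.source →
    (e x).1 * (e x).2 = d0 * (1 + (k a x).2 ^ m)
  hkε : ∀ a x, x ∈ (k a).source → ‖(k a x).2 ^ m‖ < ε
  E : α → X → ℂ
  hE1 : ∀ a x, E a x ^ m = 1
  hE : ∀ a b x, x ∈ (k a).source → x ∈ (k b).source → ∃ ζ : ℂ, ζ ^ m = 1 ∧
    ∀ᶠ x' in 𝓝 x, (k a x').2 = ζ * (k b x').2 ∧ E a x' = ζ * E b x'
  a0 : α

namespace Pre
variable {X : Type} [TopologicalSpace X] {m : ℕ} {α : Type} {d0 : ℂ}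
    {e : OpenPartialHomeomorph X (ℂ × ℂ)} {ε : ℝ}

theorem dense (N : Pre X m α d0 e ε) : Dense e.source := by
  intro x
  by_cases hx : x ∈ e.source
  · exact subset_closure hx
  obtain ⟨a, ha⟩ := N.hcov x hx
  have hw : (N.k a x).2 = 0 := by
    by_contra h
    exact hx ((N.hke a x ha).1 h)
  have ht := (N.k a).map_source ha
  have h1 : N.k a x ∈ closure ((N.k a).target ∩ {q | q.2 ≠ 0}) := by
    apply (N.k a).open_target.inter_closure
    refine ⟨ht, ?_⟩
    have h2 : ContinuousAt (fun t : ℂ => ((N.k a x).1, t)) 0 := by fun_prop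
    have h3 : (0 : ℂ) ∈ closure ({0}ᶜ : Set ℂ) := by
      have := dense_compl_singleton (0 : ℂ)
      exact this 0
    have h4 := h2.continuousWithinAt.mem_closure_image h3
    have e1 : ((N.k a x).1, (0 : ℂ)) = N.k a x := Prod.ext rfl hw.symm
    rw [e1] at h4
    refine closure_mono ?_ h4
    rintro _ ⟨t, ht, rfl⟩
    exact ht
  have h5 := ((N.k a).continuousAt_symm ht).continuousWithinAt.mem_closure_image h1
  rw [(N.k a).left_inv ha] at h5
  refine closure_mono ?_ h5
  rintro _ ⟨q, ⟨hq, hq0⟩, rfl⟩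
  apply (N.hke a _ ((N.k a).map_target hq)).1
  rw [(N.k a).right_inv hq]
  exact hq0

theorem null (N : Pre X m α d0 e ε) (a : α) : ∀ x y (γ γ' : Path x y), (∀ t, γ t ∈ (N.k a).source) →
    (∀ t, γ' t ∈ (N.k a).source) → γ.Homotopic γ' := by
  have hs := starConvex_zero_iff.1 (N.hstar a)
  apply hnull_of_contraction _ (fun q => (N.k a).symm ((1 - (q.1 : ℝ)) • N.k a q.2))
    ((N.k a).symm 0)
  · refine (N.k a).continuousOn_symm.comp (t := (N.k a).target) ?_ ?_
    · refine ContinuousOn.fun_smul (by fun_prop) ?_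
      exact (N.k a).continuousOn.comp continuousOn_snd (fun q hq => hq.2)
    · rintro ⟨t, x⟩ ⟨-, hx⟩
      exact hs ((N.k a).map_source hx) (by linarith [t.2.2]) (by linarith [t.2.1])
  · intro x hx
    simp [(N.k a).left_inv hx]
  · intro x hx
    simp

theorem conn (N : Pre X m α d0 e ε) (a : α) : ∀ x y, x ∈ (N.k a).source → x ∈ e.source → y ∈ (N.k a).source →
    y ∈ e.source → JoinedIn ((N.k a).source ∩ e.source) x y := by
  have h := (N.hconn a).image' (f := (N.k a).symm)
    ((N.k a).continuousOn_symm.mono inter_subset_left)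
  intro x y hx hx' hy hy'
  have key : ∀ x, x ∈ (N.k a).source → x ∈ e.source →
      x ∈ (N.k a).symm '' ((N.k a).target ∩ {q | q.2 ≠ 0}) := by
    intro x hx hx'
    exact ⟨N.k a x, ⟨(N.k a).map_source hx, (N.hke a x hx).2 hx'⟩, (N.k a).left_inv hx⟩
  refine (h.joinedIn x (key x hx hx') y (key y hy hy')).mono ?_
  rintro _ ⟨q, ⟨hq, hq0⟩, rfl⟩
  refine ⟨(N.k a).map_target hq, ?_⟩
  apply (N.hke a _ ((N.k a).map_target hq)).1
  rw [(N.k a).right_inv hq]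
  exact hq0

theorem exists_rho (N : Pre X m α d0 e ε) : ∃ ρ : ℝ, 0 < ρ ∧ ∀ w : ℂ, ‖w‖ = ρ → ((0 : ℂ), w) ∈ (N.k N.a0).target := by
  have h1 := (N.k N.a0).open_target.mem_nhds (N.h0 N.a0)
  have h2 : Tendsto (fun w : ℂ => ((0 : ℂ), w)) (𝓝 0) (𝓝 0) := by
    have : ContinuousAt (fun w : ℂ => ((0 : ℂ), w)) 0 := by fun_prop
    exact this
  obtain ⟨ρ, hρ, h3⟩ := Metric.mem_nhds_iff.1 (h2 h1)
  refine ⟨ρ / 2, by positivity, ?_⟩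
  intro w hw
  apply h3
  simp [hw]
  linarith

end Pre

theorem pre_pi1 {X : Type} [TopologicalSpace X] [LocallyPathConnectedSpace X] {n m : ℕ} (hm : 0 < m)
    {α : Type} [Finite α]
    (d : Fin (n + 1) → ℂ) (hd0 : ∀ i, d i ≠ 0) (hinj : Function.Injective d)
    (e : OpenPartialHomeomorph X (ℂ × ℂ)) (he : e.target = {q | ∀ i, q.1 * q.2 ≠ d i})
    (H : ∀ ε : ℝ, 0 < ε → Nonempty (Pre X m α (d 0) e ε))
    {O : Type} [Group O] (g : Fin (n + 1) → O)
    (hg : Subgroup.closure (range g) = ⊤) (hg0 : g 0 ^ m = 1)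
    (huniv : ∀ (G : Type) [Group G] (T : Fin (n + 1) → G), T 0 ^ m = 1 →
      ∃ Φ : O →* G, ∀ i, Φ (g i) = T i) :
    ∀ x : X, Nonempty (FundamentalGroup X x ≃* O) := by
  obtain ⟨φ, hφ, η, hη, hφ0, hφd⟩ := exists_twist d hd0 hinj
  let p : Fin (n + 1) → ℂ := fun i => d i * Complex.exp (φ ‖d i‖ * Complex.I)
  have hp : ∀ i, p i ≠ 0 := fun i => mul_ne_zero (hd0 i) (Complex.exp_ne_zero _)
  obtain ⟨ε, hε, hε1, hcone⟩ := exists_cone p hp hφd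
  have hn0 : 0 < ‖d 0‖ := norm_pos_iff.2 (hd0 0)
  have hp0 : p 0 = d 0 := by
    simp only [p]
    rw [hφ0 _ (by simp [hη.le])]
    simp
  obtain ⟨N⟩ := H (min (ε / 2) (η / ‖d 0‖)) (by positivity)
  obtain ⟨ρ, hρ, hρt⟩ := N.exists_rho
  have hFt : ∀ θ : ℝ, ((0 : ℂ), (ρ : ℂ) * Complex.exp (θ * Complex.I)) ∈ (N.k N.a0).target := by
    intro θ
    apply hρt
    rw [norm_mul, Complex.norm_exp_ofReal_mul_I, mul_one, Complex.norm_real, Real.norm_eq_abs,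
      abs_of_pos hρ]
  let M : Model X n m α :=
    { hm := hm
      p := p
      hp := hp
      e := e.trans (twist φ hφ).toOpenPartialHomeomorph
      he := by
        ext q
        simp only [OpenPartialHomeomorph.trans_target, Homeomorph.toOpenPartialHomeomorph_target,
          univ_inter, mem_preimage, he, mem_ofPred_eq,
          Homeomorph.toOpenPartialHomeomorph_symm_apply]
        obtain ⟨q, rfl⟩ := (twist φ hφ).surjective q
        rw [Homeomorph.symm_apply_apply]
        refine forall_congr' fun i => not_congr ?_
        rw [twist_prod]
        constructor
        · intro h; rw [h]
        · intro h; exact tw_inj φ _ _ h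
      hed := by simpa using N.dense
      ε := ε
      hε := hε
      hε1 := hε1
      hcone := hcone
      Q := fun a => (N.k a).source
      hQ := fun a => (N.k a).open_source
      hcov := by
        intro x hx
        apply N.hcov
        simpa using hx
      w := fun a x => (N.k a x).2
      hw := fun a => continuous_snd.comp_continuousOn (N.k a).continuousOn
      hwe := by
        intro a x hx
        rw [N.hke a x hx]
        simp
      hwd := by
        intro a x hx hxe
        have hxe' : x ∈ e.source := by simpa using hxe
        have h1 := N.hkd a x hx hxe'
        have h2 := (N.hkε a x hx).trans_le (min_le_right _ _)
        rw [lt_div_iff₀ hn0] at h2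
        have h3 : (e.trans (twist φ hφ).toOpenPartialHomeomorph) x = twist φ hφ (e x) := rfl
        rw [h3, twist_prod, hp0, h1, hφ0]
        · simp
        · have := abs_norm_sub_norm_le (d 0 * (1 + (N.k a x).2 ^ m)) (d 0)
          refine this.trans ?_
          rw [show d 0 * (1 + (N.k a x).2 ^ m) - d 0 = (N.k a x).2 ^ m * d 0 by ring, norm_mul]
          exact h2.le
      hwε := fun a x hx => (N.hkε a x hx).trans_le (min_le_left _ _)
      hQnull := fun a => N.null a
      hQconn := by
        intro a x y hx hx' hy hy'
        have := N.conn a x y hx (by simpa using hx') hy (by simpa using hy')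
        simpa using this
      E := N.E
      hE1 := N.hE1
      hE := N.hE
      a0 := N.a0
      ρ := ρ
      hρ := hρ
      F := fun θ => (N.k N.a0).symm ((0 : ℂ), (ρ : ℂ) * Complex.exp (θ * Complex.I))
      hF := by
        exact (N.k N.a0).continuousOn_symm.comp_continuous (by fun_prop) hFt
      hFQ := fun θ => (N.k N.a0).map_target (hFt θ)
      hFw := by
        intro θ
        rw [(N.k N.a0).right_inv (hFt θ)]
      hFper := by
        intro θ
        congr 3
        push_cast
        rw [add_mul, Complex.exp_add, Complex.exp_two_pi_mul_I, mul_one] }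
  exact M.model_pi1 g hg hg0 huniv

theorem exists_restr {P Y : Type} [TopologicalSpace P] [TopologicalSpace Y]
    (e : OpenPartialHomeomorph P Y) (S : Set P) (hS : IsOpen S) (hne : Nonempty S) :
    ∃ e' : OpenPartialHomeomorph S Y, e'.source = Subtype.val ⁻¹' e.source ∧
      e'.target = e.target ∩ e.symm ⁻¹' S ∧ ∀ x, e' x = e x := by
  refine ⟨e.subtypeRestr (s := ⟨S, hS⟩) hne, ?_, ?_, fun x => rfl⟩
  · exact e.subtypeRestr_source (s := ⟨S, hS⟩) hne
  · simp [OpenPartialHomeomorph.subtypeRestr_def]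

/-- Charts near the orbifold locus, in an ambient space. -/
structure PreP (P : Type) [TopologicalSpace P] (S : Set P) (m : ℕ) (α : Type) (d0 : ℂ)
    (e : OpenPartialHomeomorph P (ℂ × ℂ)) (ε : ℝ) where
  k : α → OpenPartialHomeomorph P (ℂ × ℂ)
  hkS : ∀ a, (k a).source ⊆ S
  hcov : ∀ x ∈ S, x ∉ e.source → ∃ a, x ∈ (k a).source
  hstar : ∀ a, StarConvex ℝ 0 (k a).target
  h0 : ∀ a, 0 ∈ (k a).target
  hconn : ∀ a, IsPathConnected ((k a).target ∩ {q | q.2 ≠ 0})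
  hke : ∀ a x, x ∈ (k a).source → ((k a x).2 ≠ 0 ↔ x ∈ e.source)
  hkd : ∀ a x, x ∈ (k a).source → x ∈ e.source →
    (e x).1 * (e x).2 = d0 * (1 + (k a x).2 ^ m)
  hkε : ∀ a x, x ∈ (k a).source → ‖(k a x).2 ^ m‖ < ε
  E : α → P → ℂ
  hE1 : ∀ a x, E a x ^ m = 1
  hE : ∀ a b x, x ∈ (k a).source → x ∈ (k b).source → ∃ ζ : ℂ, ζ ^ m = 1 ∧
    ∀ᶠ x' in 𝓝 x, (k a x').2 = ζ * (k b x').2 ∧ E a x' = ζ * E b x'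
  a0 : α

theorem preP_pi1 {P : Type} [TopologicalSpace P] [LocallyPathConnectedSpace P] (S : Set P)
    (hS : IsOpen S) {n m : ℕ} (hm : 0 < m)
    {α : Type} [Finite α]
    (d : Fin (n + 1) → ℂ) (hd0 : ∀ i, d i ≠ 0) (hinj : Function.Injective d)
    (e : OpenPartialHomeomorph P (ℂ × ℂ)) (he : e.target = {q | q.1 * q.2 ≠ d 0})
    (heS : ∀ x ∈ e.source, x ∈ S ↔ ∀ i, i ≠ 0 → (e x).1 * (e x).2 ≠ d i)
    (H : ∀ ε : ℝ, 0 < ε → Nonempty (PreP P S m α (d 0) e ε))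
    {O : Type} [Group O] (g : Fin (n + 1) → O)
    (hg : Subgroup.closure (range g) = ⊤) (hg0 : g 0 ^ m = 1)
    (huniv : ∀ (G : Type) [Group G] (T : Fin (n + 1) → G), T 0 ^ m = 1 →
      ∃ Φ : O →* G, ∀ i, Φ (g i) = T i) :
    ∀ x : S, Nonempty (FundamentalGroup S x ≃* O) := by
  intro x
  have hne : Nonempty S := ⟨x⟩
  have : LocallyPathConnectedSpace S := hS.locallyPathConnectedSpace
  obtain ⟨e', he1, he2, he3⟩ := exists_restr e S hS hne
  refine pre_pi1 hm (α := α) d hd0 hinj e' ?_ ?_ g hg hg0 huniv x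
  · rw [he2]
    ext q
    simp only [mem_inter_iff, mem_preimage, mem_ofPred_eq]
    constructor
    · rintro ⟨h1, h2⟩ i
      have h3 := (heS _ (e.map_target h1)).1 h2
      rw [e.right_inv h1] at h3
      by_cases hi : i = 0
      · subst hi
        rw [he] at h1; exact h1
      · exact h3 i hi
    · intro h
      have h1 : q ∈ e.target := by rw [he]; exact h 0
      refine ⟨h1, ?_⟩
      rw [heS _ (e.map_target h1), e.right_inv h1]
      exact fun i _ => h i
  · intro ε hε
    obtain ⟨N⟩ := H ε hε
    choose k hk1 hk2 hk3 using fun a => exists_restr (N.k a) S hS hne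
    have hk2' : ∀ a, (k a).target = (N.k a).target := by
      intro a
      rw [hk2]
      ext q
      simp only [mem_inter_iff, mem_preimage, and_iff_left_iff_imp]
      intro hq
      exact N.hkS a ((N.k a).map_target hq)
    exact ⟨{
      k := k
      hcov := by
        intro x hx
        rw [he1] at hx
        obtain ⟨a, ha⟩ := N.hcov x x.2 hx
        exact ⟨a, by rw [hk1]; exact ha⟩
      hstar := fun a => by rw [hk2']; exact N.hstar a
      h0 := fun a => by rw [hk2']; exact N.h0 a
      hconn := fun a => by rw [hk2']; exact N.hconn a
      hke := by
        intro a x hx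
        rw [hk1] at hx
        rw [he1, hk3]
        exact N.hke a x hx
      hkd := by
        intro a x hx hx'
        rw [hk1] at hx
        rw [he1] at hx'
        rw [he3, hk3]
        exact N.hkd a x hx hx'
      hkε := by
        intro a x hx
        rw [hk1] at hx
        rw [hk3]
        exact N.hkε a x hx
      E := fun a x => N.E a x
      hE1 := fun a x => N.hE1 a x
      hE := by
        intro a b x ha hb
        rw [hk1] at ha hb
        obtain ⟨ζ, h1, h2⟩ := N.hE a b x ha hb
        refine ⟨ζ, h1, ?_⟩
        have := (continuous_subtype_val.tendsto x).eventually h2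
        filter_upwards [this] with x' hx'
        rw [hk3, hk3]
        exact hx'
      a0 := N.a0 }⟩

end FGP
end

section
open Set Topology Filter unitInterval
namespace FGP

/-- Generators of `F_{r+1} * Z_m`. -/
noncomputable def gO (r m : ℕ) : Fin (r+1+1) → Monoid.Coprod (FreeGroup (Fin (r + 1))) (Multiplicative (ZMod m)) :=
  Fin.cons (Monoid.Coprod.inr (Multiplicative.ofAdd 1))
    (fun i => Monoid.Coprod.inl (FreeGroup.of i))

theorem gO_zero_pow (r m : ℕ) : gO r m 0 ^ m = 1 := by
  simp only [gO, Fin.cons_zero]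
  rw [← map_pow, ← ofAdd_nsmul]
  simp

theorem gO_closure (r m : ℕ) [NeZero m] : Subgroup.closure (range (gO r m)) = ⊤ := by
  rw [eq_top_iff, ← Monoid.Coprod.range_inl_sup_range_inr, sup_le_iff]
  constructor
  · rw [MonoidHom.range_eq_map, ← FreeGroup.closure_range_of, MonoidHom.map_closure,
      Subgroup.closure_le]
    rintro _ ⟨_, ⟨i, rfl⟩, rfl⟩
    exact Subgroup.subset_closure ⟨i.succ, by simp [gO]⟩
  · rintro _ ⟨y, rfl⟩
    have : y = (Multiplicative.ofAdd (1 : ZMod m)) ^ (y.toAdd.val) := by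
      rw [← ofAdd_nsmul]
      simp
    rw [this, map_pow]
    apply Subgroup.pow_mem
    exact Subgroup.subset_closure ⟨0, by simp [gO]⟩

theorem gO_univ (r m : ℕ) (G : Type) [Group G] (T : Fin (r+1+1) → G) (hT : T 0 ^ m = 1) :
    ∃ Φ : Monoid.Coprod (FreeGroup (Fin (r + 1))) (Multiplicative (ZMod m)) →* G,
      ∀ i, Φ (gO r m i) = T i := by
  let z : Multiplicative (ZMod m) →* G := AddMonoidHom.toMultiplicativeLeft
    (ZMod.lift m ⟨zmultiplesHom (Additive G) (Additive.ofMul (T 0)), by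
      simp [← ofMul_pow, hT]⟩)
  refine ⟨Monoid.Coprod.lift (FreeGroup.lift (fun i => T i.succ)) z, ?_⟩
  intro i
  refine Fin.cases ?_ (fun i => ?_) i
  · simp only [gO, Fin.cons_zero, Monoid.Coprod.lift_apply_inr]
    have h := ZMod.lift_coe m ⟨zmultiplesHom (Additive G) (Additive.ofMul (T 0)), by
      simp [← ofMul_pow, hT]⟩ 1
    simp at h
    simp [z, h]
  · simp [gO]

end FGP
end

section
open Set Topology Filter unitInterval
namespace FGP

theorem isQuotientMap_mk' : IsQuotientMap (Projectivization.mk' ℂ : {v : Fin 3 → ℂ // v ≠ 0} → P2) :=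
  isQuotientMap_quot_mk

instance : LocallyPathConnectedSpace P2 := by
  have : LocallyPathConnectedSpace {v : Fin 3 → ℂ // v ≠ 0} :=
    (isOpen_ne (x := (0 : Fin 3 → ℂ))).locallyPathConnectedSpace
  exact isQuotientMap_mk'.locallyPathConnectedSpace

theorem rep_mk' (v : {v : Fin 3 → ℂ // v ≠ 0}) :
    ∃ c : ℂ, c ≠ 0 ∧ (Projectivization.mk' ℂ v).rep = c • (v : Fin 3 → ℂ) := by
  obtain ⟨a, ha⟩ := Projectivization.exists_smul_eq_mk_rep ℂ v.1 v.2
  exact ⟨a, a.ne_zero, ha.symm⟩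

/-- Invariant sets. -/
def Inv (D : Set (Fin 3 → ℂ)) : Prop := ∀ v ∈ D, ∀ c : ℂ, c ≠ 0 → c • v ∈ D

theorem Inv.iff {D} (h : Inv D) (v : Fin 3 → ℂ) (c : ℂ) (hc : c ≠ 0) : c • v ∈ D ↔ v ∈ D := by
  refine ⟨fun hv => ?_, fun hv => h v hv c hc⟩
  have := h _ hv c⁻¹ (inv_ne_zero hc)
  rwa [smul_smul, inv_mul_cancel₀ hc, one_smul] at this

theorem Inv.preimage {D} (h : Inv D) :
    (Projectivization.mk' ℂ) ⁻¹' {p : P2 | p.rep ∈ D} = Subtype.val ⁻¹' D := by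
  ext v
  obtain ⟨c, hc, h1⟩ := rep_mk' v
  simp only [mem_preimage, mem_ofPred_eq, h1, h.iff _ _ hc]

theorem Inv.isOpen {D} (h : Inv D) (hD : IsOpen D) : IsOpen {p : P2 | p.rep ∈ D} := by
  rw [← isQuotientMap_mk'.isOpen_preimage, h.preimage]
  exact hD.preimage continuous_subtype_val

open Classical in
/-- Total version of the projection. -/
noncomputable def mk0 (v : Fin 3 → ℂ) : P2 := if h : v ≠ 0 then Projectivization.mk ℂ v h else Classical.arbitrary _

theorem mk0_eq (v : {v : Fin 3 → ℂ // v ≠ 0}) : mk0 v = Projectivization.mk' ℂ v := by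
  simp [mk0, v.2]

theorem rep_mk0 (v : Fin 3 → ℂ) (hv : v ≠ 0) : ∃ c : ℂ, c ≠ 0 ∧ (mk0 v).rep = c • v := by
  have := rep_mk' ⟨v, hv⟩
  rwa [← mk0_eq] at this

theorem mk0_smul_rep (p : P2) (c : ℂ) (hc : c ≠ 0) : mk0 (c • p.rep) = p := by
  have h : c • p.rep ≠ 0 := smul_ne_zero hc p.rep_nonzero
  rw [mk0, dif_pos h]
  conv_rhs => rw [← p.mk_rep]
  rw [Projectivization.mk_eq_mk_iff']
  exact ⟨c, rfl⟩

theorem continuousOn_mk0 : ContinuousOn mk0 {v | v ≠ 0} := by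
  rw [continuousOn_iff_continuous_domRestrict]
  have : Set.domRestrict {v : Fin 3 → ℂ | v ≠ 0} mk0 = Projectivization.mk' ℂ := by
    ext v : 1
    exact mk0_eq v
  rw [this]
  exact isQuotientMap_mk'.continuous

/-- Charts on the projective plane. -/
noncomputable def chart (D : Set (Fin 3 → ℂ)) (T : Set (ℂ × ℂ)) (F : (Fin 3 → ℂ) → ℂ × ℂ)
    (G : ℂ × ℂ → (Fin 3 → ℂ)) (hDi : Inv D) (hD0 : ∀ v ∈ D, v ≠ 0) (hDo : IsOpen D) (hTo : IsOpen T)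
    (hFi : ∀ v ∈ D, ∀ c : ℂ, c ≠ 0 → F (c • v) = F v)
    (hF : ContinuousOn F D) (hG : ContinuousOn G T) (hFT : ∀ v ∈ D, F v ∈ T)
    (hGD : ∀ q ∈ T, G q ∈ D) (hFG : ∀ q ∈ T, F (G q) = q)
    (hGF : ∀ v ∈ D, ∃ c : ℂ, c ≠ 0 ∧ G (F v) = c • v) : OpenPartialHomeomorph P2 (ℂ × ℂ) where
  toFun p := F p.rep
  invFun q := mk0 (G q)
  source := {p | p.rep ∈ D}
  target := T
  map_source' p hp := hFT _ hp
  map_target' q hq := by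
    obtain ⟨c, hc, h⟩ := rep_mk0 _ (hD0 _ (hGD q hq))
    rw [mem_ofPred_eq, h]
    exact hDi _ (hGD q hq) c hc
  left_inv' p hp := by
    obtain ⟨c, hc, h⟩ := hGF _ hp
    rw [h, mk0_smul_rep _ _ hc]
  right_inv' q hq := by
    obtain ⟨c, hc, h⟩ := rep_mk0 _ (hD0 _ (hGD q hq))
    rw [h, hFi _ (hGD q hq) c hc, hFG q hq]
  open_source := hDi.isOpen hDo
  open_target := hTo
  continuousOn_toFun := by
    rw [isQuotientMap_mk'.continuousOn_isOpen_iff (hDi.isOpen hDo), hDi.preimage]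
    have : ContinuousOn (F ∘ (Subtype.val : {v : Fin 3 → ℂ // v ≠ 0} → _)) (Subtype.val ⁻¹' D) :=
      hF.comp continuous_subtype_val.continuousOn (fun _ h => h)
    refine this.congr ?_
    intro v hv
    obtain ⟨c, hc, h⟩ := rep_mk' v
    simp only [Function.comp_apply, h]
    exact hFi _ hv c hc
  continuousOn_invFun := continuousOn_mk0.comp hG (fun q hq => hD0 _ (hGD q hq))

end FGP
end

section
open Set Topology Filter unitInterval
namespace FGP

/-- The conic. -/
def f2 (v : Fin 3 → ℂ) : ℂ := v 1 * v 2 - v 0 ^ 2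
/-- The nodal cubic. -/
def f3 (v : Fin 3 → ℂ) : ℂ := 40 * v 1 ^ 3 + 21 * v 0 * f2 v

theorem f2_smul (c : ℂ) (v) : f2 (c • v) = c ^ 2 * f2 v := by
  simp only [f2, Pi.smul_apply, smul_eq_mul]; ring
theorem f3_smul (c : ℂ) (v) : f3 (c • v) = c ^ 3 * f3 v := by
  simp only [f3, f2_smul, Pi.smul_apply, smul_eq_mul]; ring
theorem continuous_f2 : Continuous f2 := by unfold f2; fun_prop
theorem continuous_f3 : Continuous f3 := by unfold f3 f2; fun_prop

/-- The affine chart in coordinates `(x/y, f₂/y²)`. -/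
noncomputable def aff : OpenPartialHomeomorph P2 (ℂ × ℂ) :=
  chart {v | v 1 ≠ 0} univ (fun v => (v 0 / v 1, f2 v / v 1 ^ 2))
    (fun q => ![q.1, 1, q.2 + q.1 ^ 2])
    (by
      intro v hv c hc
      simpa [hc] using hv)
    (by rintro v hv rfl; simp at hv)
    (isOpen_ne_fun (by fun_prop) (by fun_prop)) isOpen_univ
    (by
      intro v hv c hc
      have hv : v 1 ≠ 0 := hv
      simp only [f2_smul, Pi.smul_apply, smul_eq_mul, Prod.mk.injEq]
      constructor <;> field_simp)
    (by
      have := continuous_f2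
      apply ContinuousOn.prodMk
      · exact ContinuousOn.div (by fun_prop) (by fun_prop) (fun v hv => hv)
      · exact ContinuousOn.div (by fun_prop) (by fun_prop) (fun v hv => pow_ne_zero _ hv))
    (by
      apply Continuous.continuousOn
      refine continuous_pi (fun i => ?_)
      fin_cases i <;> simp <;> fun_prop)
    (fun _ _ => mem_univ _) (by intro q hq; simp)
    (by rintro ⟨x, u⟩ hq; simp [f2])
    (by
      intro v hv
      have hv : v 1 ≠ 0 := hv
      refine ⟨1 / v 1, by simpa using hv, ?_⟩
      ext i
      fin_cases i
      · simp; field_simp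
      · simp [hv]
      · simp [f2]; field_simp; ring)

theorem aff_source (p : P2) : p ∈ aff.source ↔ p.rep 1 ≠ 0 := Iff.rfl
theorem aff_target : aff.target = univ := rfl
theorem aff_apply (p : P2) : aff p = (p.rep 0 / p.rep 1, f2 p.rep / p.rep 1 ^ 2) := rfl

theorem aff_f2 (p : P2) (hp : p ∈ aff.source) : f2 p.rep = p.rep 1 ^ 2 * (aff p).2 := by
  have : p.rep 1 ≠ 0 := hp
  rw [aff_apply]; field_simp
theorem aff_f3 (p : P2) (hp : p ∈ aff.source) :
    f3 p.rep = p.rep 1 ^ 3 * (40 + 21 * (aff p).1 * (aff p).2) := by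
  have : p.rep 1 ≠ 0 := hp
  rw [aff_apply, f3]; field_simp

/-- The inverse of `e1`. -/
noncomputable def G1 (q : ℂ × ℂ) : Fin 3 → ℂ :=
  ![(q.1 * q.2 - 1/441 - 40 * q.1 ^ 3) / (21 * (q.1 * q.2 - 1/441)), q.1,
    q.2 - 80 * q.1 ^ 2 / (441 * (q.1 * q.2 - 1/441)) +
      1600 * q.1 ^ 5 / (441 * (q.1 * q.2 - 1/441) ^ 2)]

theorem f2_G1 (q : ℂ × ℂ) (hq : q.1 * q.2 ≠ 1 / 441) : f2 (G1 q) = q.1 * q.2 - 1/441 := by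
  obtain ⟨Y, Z⟩ := q
  simp only at hq
  have hs : Y * Z - 1 / 441 ≠ 0 := sub_ne_zero.2 hq
  obtain ⟨s, hs'⟩ : ∃ s, Y * Z - 1/441 = s := ⟨_, rfl⟩
  simp only [f2, G1, Matrix.cons_val_zero, Matrix.cons_val_one, Matrix.cons_val]
  rw [hs'] at hs ⊢
  have h2 : Y * Z = s + 1/441 := by rw [← hs']; ring
  have : Y * (Z - 80 * Y ^ 2 / (441 * s) + 1600 * Y ^ 5 / (441 * s ^ 2)) =
    Y * Z - 80 * Y ^ 3 / (441 * s) + 1600 * Y ^ 6 / (441 * s ^ 2) := by ring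
  rw [this, h2]
  field_simp
  ring

theorem f3_G1 (q : ℂ × ℂ) (hq : q.1 * q.2 ≠ 1 / 441) : f3 (G1 q) = q.1 * q.2 - 1/441 := by
  have hs : q.1 * q.2 - 1 / 441 ≠ 0 := sub_ne_zero.2 hq
  rw [f3, f2_G1 q hq]
  simp only [G1, Matrix.cons_val_zero, Matrix.cons_val_one]
  obtain ⟨s, hs'⟩ : ∃ s, q.1 * q.2 - 1/441 = s := ⟨_, rfl⟩
  rw [hs'] at hs ⊢
  field_simp
  ring

/-- Forward map of `e1`. -/
noncomputable def F1 (v : Fin 3 → ℂ) : ℂ × ℂ :=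
  (v 1 * f2 v / f3 v, v 2 * f2 v / f3 v + 80 * v 1 ^ 2 / (441 * f2 v)
    - 1600 * v 1 ^ 5 / (441 * f2 v * f3 v))

theorem F1_mul (v : Fin 3 → ℂ) (h2 : f2 v ≠ 0) (h3 : f3 v ≠ 0) :
    (F1 v).1 * (F1 v).2 = f2 v ^ 3 / f3 v ^ 2 + 1 / 441 := by
  have e3 : f3 v = 40 * v 1 ^ 3 + 21 * v 0 * f2 v := rfl
  have e2 : v 1 * v 2 = f2 v + v 0 ^ 2 := by rw [f2]; ring
  simp only [F1]
  generalize f3 v = w at *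
  generalize f2 v = g at *
  field_simp
  have : v 1 * (441 * v 2 * g ^ 2 + 80 * v 1 ^ 2 * w - 1600 * v 1 ^ 5) =
    441 * (v 1 * v 2) * g ^ 2 + 80 * v 1 ^ 3 * w - 1600 * v 1 ^ 6 := by ring
  have h5 : w ^ 2 = (40 * v 1 ^ 3 + 21 * v 0 * g) ^ 2 := by rw [e3]
  linear_combination (441 * g ^ 2) * e2 + 80 * v 1 ^ 3 * e3 - h5

theorem G1_F1 (v : Fin 3 → ℂ) (h2 : f2 v ≠ 0) (h3 : f3 v ≠ 0) :
    G1 (F1 v) = (f2 v / f3 v) • v := by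
  have hm := F1_mul v h2 h3
  have e3 : f3 v = 40 * v 1 ^ 3 + 21 * v 0 * f2 v := rfl
  have hs : (F1 v).1 * (F1 v).2 - 1 / 441 = f2 v ^ 3 / f3 v ^ 2 := by rw [hm]; ring
  ext i
  simp only [G1, hs]
  fin_cases i
  · simp [F1]
    generalize f3 v = w at *
    generalize f2 v = g at *
    field_simp
    linear_combination e3
  · simp [F1]; field_simp
  · simp [F1]; field_simp; ring

/-- The chart on the complement of the conic and the cubic. -/
noncomputable def e1 : OpenPartialHomeomorph P2 (ℂ × ℂ) :=
  chart {v | f2 v ≠ 0 ∧ f3 v ≠ 0} {q | q.1 * q.2 ≠ 1 / 441} F1 G1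
    (by
      rintro v ⟨h2, h3⟩ c hc
      simp only [mem_ofPred_eq, f2_smul, f3_smul]
      exact ⟨by positivity, by positivity⟩)
    (by rintro v ⟨hv, -⟩ rfl; simp [f2] at hv)
    ((isOpen_ne_fun continuous_f2 continuous_const).inter
      (isOpen_ne_fun continuous_f3 continuous_const))
    (isOpen_ne_fun (by fun_prop) (by fun_prop))
    (by
      rintro v ⟨h2, h3⟩ c hc
      simp only [F1, f2_smul, f3_smul, Pi.smul_apply, smul_eq_mul, Prod.mk.injEq]
      constructor <;> field_simp)
    (by
      have c2 := continuous_f2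
      have c3 := continuous_f3
      unfold F1
      refine ContinuousOn.prodMk ?_ (ContinuousOn.sub (ContinuousOn.add ?_ ?_) ?_)
      all_goals refine ContinuousOn.div (by fun_prop) (by fun_prop) ?_
      all_goals
        rintro v ⟨h2, h3⟩
        first
        | exact h3
        | exact mul_ne_zero (by norm_num) h2
        | exact mul_ne_zero (mul_ne_zero (by norm_num) h2) h3)
    (by
      have h : ∀ q ∈ {q : ℂ × ℂ | q.1 * q.2 ≠ 1 / 441}, q.1 * q.2 - 1 / 441 ≠ 0 :=
        fun q hq => sub_ne_zero.2 hq
      rw [continuousOn_pi]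
      intro i
      fin_cases i
      · simp only [G1, Fin.zero_eta, Matrix.cons_val_zero]
        refine ContinuousOn.div (by fun_prop) (by fun_prop) (fun q hq => ?_)
        exact mul_ne_zero (by norm_num) (h q hq)
      · simp [G1]; fun_prop
      · simp only [G1, Fin.reduceFinMk, Matrix.cons_val]
        refine ContinuousOn.add (ContinuousOn.sub (by fun_prop) ?_) ?_
        all_goals
          refine ContinuousOn.div (by fun_prop) (by fun_prop) (fun q hq => ?_)
          first
          | exact mul_ne_zero (by norm_num) (h q hq)
          | exact mul_ne_zero (by norm_num) (pow_ne_zero _ (h q hq)))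
    (by
      rintro v ⟨h2, h3⟩
      rw [mem_ofPred_eq, F1_mul v h2 h3]
      intro h
      have : f2 v ^ 3 / f3 v ^ 2 = 0 := by linear_combination h
      revert this
      positivity)
    (by
      intro q hq
      rw [mem_ofPred_eq, f2_G1 q hq, f3_G1 q hq]
      have := sub_ne_zero.2 hq
      exact ⟨this, this⟩)
    (by
      intro q hq
      have hs := sub_ne_zero.2 hq
      rw [F1, f2_G1 q hq, f3_G1 q hq]
      simp only [G1, Matrix.cons_val_one, Matrix.cons_val]
      generalize q.1 * q.2 - 1 / 441 = s at *
      ext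
      · simp; field_simp
      · simp only []; field_simp; ring)
    (by
      rintro v ⟨h2, h3⟩
      exact ⟨f2 v / f3 v, by positivity, G1_F1 v h2 h3⟩)

theorem e1_source (p : P2) : p ∈ e1.source ↔ f2 p.rep ≠ 0 ∧ f3 p.rep ≠ 0 := Iff.rfl
theorem e1_target : e1.target = {q | q.1 * q.2 ≠ 1 / 441} := rfl
theorem e1_mul (p : P2) (hp : p ∈ e1.source) :
    (e1 p).1 * (e1 p).2 = f2 p.rep ^ 3 / f3 p.rep ^ 2 + 1 / 441 := F1_mul _ hp.1 hp.2

/-- Change of coordinates between the two orbifold structures. -/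
noncomputable def tau : OpenPartialHomeomorph (ℂ × ℂ) (ℂ × ℂ) where
  toFun q := (q.1, 441 * q.2 / (q.1 * q.2 - 1 / 441))
  invFun q := (q.1, q.2 / (441 * (q.1 * q.2 - 441)))
  source := {q | q.1 * q.2 ≠ 1 / 441}
  target := {q | q.1 * q.2 ≠ 441}
  map_source' := by
    rintro ⟨Y, Z⟩ hq
    have h := sub_ne_zero.2 hq
    simp only [mem_ofPred_eq, ne_eq] at h ⊢
    rw [← mul_div_assoc, div_eq_iff h]
    intro h2
    have : (1 : ℂ) = 0 := by linear_combination h2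
    exact one_ne_zero this
  map_target' := by
    rintro ⟨Y, Z⟩ hq
    have h := sub_ne_zero.2 hq
    simp only [mem_ofPred_eq, ne_eq] at h ⊢
    rw [← mul_div_assoc, div_eq_iff (mul_ne_zero (by norm_num) h)]
    intro h2
    have : (441 : ℂ) = 0 := by linear_combination h2
    norm_num at this
  left_inv' := by
    rintro ⟨Y, Z⟩ hq
    have h := sub_ne_zero.2 hq
    simp only at h ⊢
    have h1 : Y * (441 * Z / (Y * Z - 1 / 441)) - 441 = 1 / (Y * Z - 1 / 441) := by
      rw [eq_div_iff h, sub_mul, mul_assoc, div_mul_cancel₀ _ h]; ring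
    rw [h1]
    generalize Y * Z - 1 / 441 = s at *
    ext
    · rfl
    · simp; field_simp
  right_inv' := by
    rintro ⟨Y, Z⟩ hq
    have h := sub_ne_zero.2 hq
    simp only at h ⊢
    have h1 : Y * (Z / (441 * (Y * Z - 441))) - 1 / 441 = 1 / (Y * Z - 441) := by
      field_simp
      ring
    rw [h1]
    generalize Y * Z - 441 = s at *
    ext
    · rfl
    · simp; field_simp
  open_source := isOpen_ne_fun (by fun_prop) (by fun_prop)
  open_target := isOpen_ne_fun (by fun_prop) (by fun_prop)
  continuousOn_toFun := by
    refine ContinuousOn.prodMk (by fun_prop) (ContinuousOn.div (by fun_prop) (by fun_prop) ?_)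
    exact fun q hq => sub_ne_zero.2 hq
  continuousOn_invFun := by
    refine ContinuousOn.prodMk (by fun_prop) (ContinuousOn.div (by fun_prop) (by fun_prop) ?_)
    exact fun q hq => mul_ne_zero (by norm_num) (sub_ne_zero.2 hq)

/-- The second chart on the complement of the conic and the cubic. -/
noncomputable def e2 : OpenPartialHomeomorph P2 (ℂ × ℂ) := e1.trans' tau rfl

theorem e2_source (p : P2) : p ∈ e2.source ↔ f2 p.rep ≠ 0 ∧ f3 p.rep ≠ 0 := Iff.rfl
theorem e2_target : e2.target = {q | q.1 * q.2 ≠ 441} := rfl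
theorem e2_mul (p : P2) (hp : p ∈ e2.source) :
    (e2 p).1 * (e2 p).2 = f3 p.rep ^ 2 / f2 p.rep ^ 3 + 441 := by
  have h := e1_mul p hp
  have h2 : f2 p.rep ≠ 0 := hp.1
  have h3 : f3 p.rep ≠ 0 := hp.2
  change (e1 p).1 * (441 * (e1 p).2 / ((e1 p).1 * (e1 p).2 - 1 / 441)) = _
  have : (e1 p).1 * (441 * (e1 p).2 / ((e1 p).1 * (e1 p).2 - 1 / 441)) =
    441 * ((e1 p).1 * (e1 p).2) / ((e1 p).1 * (e1 p).2 - 1 / 441) := by ring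
  rw [this, h, add_sub_cancel_right]
  field_simp
  ring

end FGP
end

section
open Set Topology Filter
namespace FGP

theorem isPathConnected_punctured (δ : ℝ) (hδ : 0 < δ) :
    IsPathConnected {w : ℂ | ‖w‖ < δ ∧ w ≠ 0} := by
  have h1 : IsPathConnected {z : ℂ | z.re < Real.log δ} :=
    (convex_halfSpace_re_lt _).isPathConnected
      ⟨((Real.log δ - 1 : ℝ) : ℂ), by rw [mem_ofPred_eq, Complex.ofReal_re]; linarith⟩
  have h2 := h1.image (f := Complex.exp) Complex.continuous_exp
  convert h2 using 1
  ext w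
  simp only [mem_ofPred_eq, mem_image]
  constructor
  · rintro ⟨h, h0⟩
    refine ⟨Complex.log w, ?_, Complex.exp_log h0⟩
    rw [Complex.log_re]
    exact Real.log_lt_log (norm_pos_iff.2 h0) h
  · rintro ⟨z, hz, rfl⟩
    refine ⟨?_, Complex.exp_ne_zero z⟩
    rw [Complex.norm_exp, ← Real.lt_log_iff_exp_lt hδ]
    exact hz

/-- The principal cube root. -/
noncomputable def cb (q : ℂ) : ℂ := q ^ ((3 : ℕ) : ℂ)⁻¹

theorem cb_pow (q : ℂ) : cb q ^ 3 = q := Complex.cpow_nat_inv_pow q (by norm_num)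
theorem cb_ne (q : ℂ) (hq : q ≠ 0) : cb q ≠ 0 := by
  intro h
  apply hq
  rw [← cb_pow q, h]; simp

theorem slit_of (q : ℂ) (h : ‖21 * q‖ < 20) : 40 + 21 * q ∈ Complex.slitPlane := by
  left
  have := Complex.abs_re_le_norm (21 * q)
  have := (abs_le.1 this).1
  rw [Complex.add_re]
  have h40 : (40 : ℂ).re = 40 := rfl
  rw [h40]
  linarith

theorem continuousAt_cb (q : ℂ) (h : q ∈ Complex.slitPlane) : ContinuousAt cb q :=
  continuousAt_id.cpow continuousAt_const h

/-- `cb(40 + 21 xu)` -/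
noncomputable def cc (q : ℂ × ℂ) : ℂ := cb (40 + 21 * (q.1 * q.2))

theorem continuousOn_cc : ContinuousOn cc {q | ‖21 * (q.1 * q.2)‖ < 20} := by
  intro q hq
  apply ContinuousAt.continuousWithinAt
  exact ContinuousAt.comp (f := fun q : ℂ × ℂ => 40 + 21 * (q.1 * q.2))
    (continuousAt_cb _ (slit_of _ hq)) (by fun_prop)

theorem cc_ne (q : ℂ × ℂ) (h : ‖21 * (q.1 * q.2)‖ < 20) : cc q ≠ 0 :=
  cb_ne _ (Complex.slitPlane_ne_zero (slit_of _ h))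

theorem cc_pow (q : ℂ × ℂ) : cc q ^ 3 = 40 + 21 * (q.1 * q.2) := cb_pow _

theorem cc_congr {q q' : ℂ × ℂ} (h : q.1 * q.2 = q'.1 * q'.2) : cc q = cc q' := by
  rw [cc, cc, h]

/-- cube root of 441 -/
noncomputable def lam : ℂ := cb 441
theorem lam_ne : lam ≠ 0 := cb_ne _ (by norm_num)
theorem lam_pow : lam ^ 3 = 441 := cb_pow _

/-- Local coordinates for the order 3 case. -/
noncomputable def kap1 (δ : ℝ) : OpenPartialHomeomorph (ℂ × ℂ) (ℂ × ℂ) where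
  toFun q := (q.1 * cc q ^ 2 / lam, lam * q.2 / cc q ^ 2)
  invFun q := (lam * q.1 / cc q ^ 2, q.2 * cc q ^ 2 / lam)
  source := {q | ‖21 * (q.1 * q.2)‖ < 20} ∩ (fun q => lam * q.2 / cc q ^ 2) ⁻¹' {w | ‖w‖ < δ}
  target := {q | ‖21 * (q.1 * q.2)‖ < 20 ∧ ‖q.2‖ < δ}
  map_source' := by
    rintro q ⟨h1, h2⟩
    have hc := cc_ne q h1
    have hl := lam_ne
    refine ⟨?_, h2⟩
    have : q.1 * cc q ^ 2 / lam * (lam * q.2 / cc q ^ 2) = q.1 * q.2 := by field_simp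
    simp only [this]
    exact h1
  map_target' := by
    rintro q ⟨h1, h2⟩
    have hc := cc_ne q h1
    have hl := lam_ne
    have h3 : lam * q.1 / cc q ^ 2 * (q.2 * cc q ^ 2 / lam) = q.1 * q.2 := by field_simp
    refine ⟨?_, ?_⟩
    · simp only [mem_ofPred_eq, h3]; exact h1
    · simp only [mem_preimage]
      rw [cc_congr (q := (_, _)) (q' := q) h3]
      have h4 : lam * (q.2 * cc q ^ 2 / lam) / cc q ^ 2 = q.2 := by field_simp
      rw [h4]
      exact h2
  left_inv' := by
    rintro q ⟨h1, h2⟩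
    have hc := cc_ne q h1
    have hl := lam_ne
    have h3 : q.1 * cc q ^ 2 / lam * (lam * q.2 / cc q ^ 2) = q.1 * q.2 := by field_simp
    simp only
    rw [cc_congr (q := (_, _)) (q' := q) h3]
    ext <;> simp only <;> field_simp
  right_inv' := by
    rintro q ⟨h1, h2⟩
    have hc := cc_ne q h1
    have hl := lam_ne
    have h3 : lam * q.1 / cc q ^ 2 * (q.2 * cc q ^ 2 / lam) = q.1 * q.2 := by field_simp
    simp only
    rw [cc_congr (q := (_, _)) (q' := q) h3]
    ext <;> simp only <;> field_simp
  open_source := by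
    apply ContinuousOn.isOpen_inter_preimage
    · have := continuousOn_cc
      exact ContinuousOn.div (by fun_prop) (by fun_prop) (fun q hq => pow_ne_zero _ (cc_ne q hq))
    · exact isOpen_lt (by fun_prop) (by fun_prop)
    · exact isOpen_lt (by fun_prop) (by fun_prop)
  open_target := by
    apply IsOpen.and
    · exact isOpen_lt (by fun_prop) (by fun_prop)
    · exact isOpen_lt (by fun_prop) (by fun_prop)
  continuousOn_toFun := by
    have := continuousOn_cc
    apply ContinuousOn.mono _ inter_subset_left
    exact ContinuousOn.prodMk
      (ContinuousOn.div (by fun_prop) (by fun_prop) (fun q hq => lam_ne))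
      (ContinuousOn.div (by fun_prop) (by fun_prop) (fun q hq => pow_ne_zero _ (cc_ne q hq)))
  continuousOn_invFun := by
    have := continuousOn_cc
    apply ContinuousOn.mono (s := {q | ‖21 * (q.1 * q.2)‖ < 20}) _ (fun q hq => hq.1)
    exact ContinuousOn.prodMk
      (ContinuousOn.div (by fun_prop) (by fun_prop) (fun q hq => pow_ne_zero _ (cc_ne q hq)))
      (ContinuousOn.div (by fun_prop) (by fun_prop) (fun q hq => lam_ne))

theorem kap1_source {δ q} : q ∈ (kap1 δ).source ↔
  ‖21 * (q.1 * q.2)‖ < 20 ∧ ‖lam * q.2 / cc q ^ 2‖ < δ := Iff.rfl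
theorem kap1_target {δ} : (kap1 δ).target = {q | ‖21 * (q.1 * q.2)‖ < 20 ∧ ‖q.2‖ < δ} := rfl
theorem kap1_two {δ q} : ((kap1 δ) q).2 = lam * q.2 / cc q ^ 2 := rfl

theorem kap1_pow {δ q} (h : q ∈ (kap1 δ).source) :
    q.2 ^ 3 * 441 = ((kap1 δ) q).2 ^ 3 * (40 + 21 * q.1 * q.2) ^ 2 := by
  have hc := cc_ne q h.1
  rw [kap1_two, mul_assoc 21, ← cc_pow, ← lam_pow]
  field_simp

theorem kap1_conn {δ : ℝ} (hδ : 0 < δ) : IsPathConnected ((kap1 δ).target ∩ {q | q.2 ≠ 0}) := by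
  have h1 : IsPathConnected {z : ℂ | ‖21 * z‖ < 20} := by
    have : {z : ℂ | ‖21 * z‖ < 20} = Metric.ball 0 (20/21) := by
      ext z; simp; constructor <;> intro h <;> linarith
    rw [this]
    exact (convex_ball _ _).isPathConnected ⟨0, by simp⟩
  have h2 := h1.prod (isPathConnected_punctured δ hδ)
  have h3 := h2.image' (f := fun q : ℂ × ℂ => (q.1 / q.2, q.2)) (by
    refine ContinuousOn.prodMk (ContinuousOn.div (by fun_prop) (by fun_prop) ?_) (by fun_prop)
    rintro q ⟨-, -, h⟩; exact h)
  convert h3 using 1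
  ext ⟨x, w⟩
  simp only [kap1_target, mem_inter_iff, mem_ofPred_eq, mem_image, mem_prod]
  constructor
  · rintro ⟨⟨h1, h2⟩, h3⟩
    refine ⟨(x * w, w), ⟨h1, h2, h3⟩, ?_⟩
    ext <;> simp [h3]
  · rintro ⟨⟨x', w'⟩, ⟨h1, h2, h3⟩, h⟩
    simp only [Prod.mk.injEq] at h
    obtain ⟨rfl, rfl⟩ := h
    exact ⟨⟨by rwa [div_mul_cancel₀ _ h3], h2⟩, h3⟩

/-- Complement of fibers and the cubic. -/
def S1 {r : ℕ} (σ : Fin r → ℂ) : Set P2 :=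
  {p | f3 p.rep ≠ 0 ∧ ∀ i, f2 p.rep ^ 3 ≠ σ i * f3 p.rep ^ 2}

/-- Complement of fibers and the conic. -/
def S2 {r : ℕ} (σ : Fin r → ℂ) : Set P2 :=
  {p | f2 p.rep ≠ 0 ∧ ∀ i, f2 p.rep ^ 3 ≠ σ i * f3 p.rep ^ 2}

theorem isOpen_S1 {r : ℕ} (σ : Fin r → ℂ) : IsOpen (S1 σ) := by
  have c2 := continuous_f2
  have c3 := continuous_f3
  refine Inv.isOpen (D := {v | f3 v ≠ 0 ∧ ∀ i, f2 v ^ 3 ≠ σ i * f3 v ^ 2}) ?_ ?_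
  · rintro v ⟨h1, h2⟩ c hc
    refine ⟨by rw [f3_smul]; positivity, fun i h => h2 i ?_⟩
    rw [f2_smul, f3_smul] at h
    have : c ^ 6 ≠ 0 := by positivity
    apply mul_left_cancel₀ this
    linear_combination h
  · refine (isOpen_ne_fun c3 continuous_const).inter ?_
    have : {v | ∀ i, f2 v ^ 3 ≠ σ i * f3 v ^ 2} = ⋂ i, {v | f2 v ^ 3 ≠ σ i * f3 v ^ 2} := by
      ext; simp
    change IsOpen {v | ∀ i, f2 v ^ 3 ≠ σ i * f3 v ^ 2}
    rw [this]
    exact isOpen_iInter_of_finite (fun i => isOpen_ne_fun (by fun_prop) (by fun_prop))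

theorem isOpen_S2 {r : ℕ} (σ : Fin r → ℂ) : IsOpen (S2 σ) := by
  have c2 := continuous_f2
  have c3 := continuous_f3
  refine Inv.isOpen (D := {v | f2 v ≠ 0 ∧ ∀ i, f2 v ^ 3 ≠ σ i * f3 v ^ 2}) ?_ ?_
  · rintro v ⟨h1, h2⟩ c hc
    refine ⟨by rw [f2_smul]; positivity, fun i h => h2 i ?_⟩
    rw [f2_smul, f3_smul] at h
    have : c ^ 6 ≠ 0 := by positivity
    apply mul_left_cancel₀ this
    linear_combination h
  · refine (isOpen_ne_fun c2 continuous_const).inter ?_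
    have : {v | ∀ i, f2 v ^ 3 ≠ σ i * f3 v ^ 2} = ⋂ i, {v | f2 v ^ 3 ≠ σ i * f3 v ^ 2} := by
      ext; simp
    change IsOpen {v | ∀ i, f2 v ^ 3 ≠ σ i * f3 v ^ 2}
    rw [this]
    exact isOpen_iInter_of_finite (fun i => isOpen_ne_fun (by fun_prop) (by fun_prop))

theorem exists_delta1 {r : ℕ} (σ : Fin r → ℂ) (hσ : ∀ i, σ i ≠ 0) (ε : ℝ) (hε : 0 < ε) :
    ∃ δ > 0, ∀ w : ℂ, ‖w‖ < δ → ‖w ^ 3‖ < ε ∧ ∀ i, w ^ 3 ≠ 441 * σ i := by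
  have h1 : ∀ᶠ w : ℂ in 𝓝 0, ‖w ^ 3‖ < ε := by
    apply ContinuousAt.eventually_lt (f := fun w : ℂ => ‖w ^ 3‖) (g := fun _ => ε) (by fun_prop)
      (by fun_prop)
    simpa using hε
  have h2 : ∀ᶠ w : ℂ in 𝓝 0, ∀ i, w ^ 3 ≠ 441 * σ i := by
    rw [eventually_all]
    intro i
    apply ContinuousAt.eventually_ne (by fun_prop)
    simpa using hσ i
  obtain ⟨δ, hδ, h⟩ := Metric.eventually_nhds_iff.1 (h1.and h2)
  exact ⟨δ, hδ, fun w hw => h (by simpa using hw)⟩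

theorem preP1 {r : ℕ} (σ : Fin r → ℂ) (hσ : ∀ i, σ i ≠ 0) (ε : ℝ) (hε : 0 < ε) :
    Nonempty (PreP P2 (S1 σ) 3 Unit (1 / 441) e1 ε) := by
  obtain ⟨δ, hδ, hw⟩ := exists_delta1 σ hσ ε hε
  have hsrc : ∀ x, x ∈ (aff.trans (kap1 δ)).source ↔ x ∈ aff.source ∧ aff x ∈ (kap1 δ).source :=
    fun x => by simp [OpenPartialHomeomorph.trans_source]
  have htgt : (aff.trans (kap1 δ)).target = (kap1 δ).target := by
    simp [OpenPartialHomeomorph.trans_target, aff_target]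
  have hq : ∀ x, x ∈ (aff.trans (kap1 δ)).source → 40 + 21 * (aff x).1 * (aff x).2 ≠ 0 := by
    intro x hx
    have := Complex.slitPlane_ne_zero (slit_of _ ((hsrc x).1 hx).2.1)
    rwa [← mul_assoc] at this
  refine ⟨{
    k := fun _ => aff.trans (kap1 δ)
    hkS := ?_
    hcov := ?_
    hstar := ?_
    h0 := ?_
    hconn := ?_
    hke := ?_
    hkd := ?_
    hkε := ?_
    E := fun _ _ => 1
    hE1 := by simp
    hE := fun a b x _ _ => ⟨1, by simp, by simp⟩
    a0 := () }⟩
  · intro _ x hx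
    obtain ⟨h1, h2⟩ := (hsrc x).1 hx
    have hy : x.rep 1 ≠ 0 := h1
    refine ⟨?_, ?_⟩
    · rw [aff_f3 x h1]
      exact mul_ne_zero (pow_ne_zero _ hy) (hq x hx)
    · intro i h
      rw [aff_f3 x h1, aff_f2 x h1] at h
      have h3 := kap1_pow h2
      refine (hw _ h2.2).2 i ?_
      apply mul_right_cancel₀ (pow_ne_zero 2 (hq x hx))
      change ((kap1 δ) (aff x)).2 ^ 3 * _ = _
      rw [← h3]
      have : x.rep 1 ^ 6 ≠ 0 := by positivity
      apply mul_left_cancel₀ this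
      linear_combination 441 * h
  · intro x hx hxe
    refine ⟨(), (hsrc x).2 ?_⟩
    have h3 := hx.1
    have h2 : f2 x.rep = 0 := by
      by_contra h
      exact hxe ⟨h, h3⟩
    have hy : x.rep 1 ≠ 0 := by
      intro h
      apply h3
      rw [f3, h2, h]; ring
    refine ⟨hy, ?_⟩
    have hu : (aff x).2 = 0 := by rw [aff_apply, h2]; simp
    rw [kap1_source, hu]
    simp [hδ]
  · intro _
    rw [htgt, kap1_target, starConvex_zero_iff]
    rintro ⟨x, w⟩ ⟨h1, h2⟩ a ha0 ha1
    simp only at h1 h2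
    refine ⟨?_, ?_⟩
    · simp only [Prod.smul_mk, Complex.real_smul]
      have : (21 : ℂ) * (a * x * (a * w)) = ((a * a : ℝ) : ℂ) * (21 * (x * w)) := by push_cast; ring
      rw [this, norm_mul, Complex.norm_real, Real.norm_of_nonneg (by positivity)]
      have : a * a ≤ 1 := by nlinarith
      nlinarith [norm_nonneg (21 * (x * w))]
    · simp only [Prod.smul_mk]
      rw [norm_smul, Real.norm_of_nonneg ha0]
      nlinarith [norm_nonneg w]
  · intro _
    rw [htgt, kap1_target]
    simp [hδ]
  · intro _
    rw [htgt]
    exact kap1_conn hδ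
  · intro _ x hx
    obtain ⟨h1, h2⟩ := (hsrc x).1 hx
    have hy : x.rep 1 ≠ 0 := h1
    have hq' := hq x hx
    have hc := cc_ne _ h2.1
    have hl := lam_ne
    rw [e1_source, aff_f2 x h1, aff_f3 x h1]
    simp only [OpenPartialHomeomorph.coe_trans, Function.comp_apply, kap1_two]
    simp [hy, hq', hc, hl]
  · intro _ x hx hxe
    obtain ⟨h1, h2⟩ := (hsrc x).1 hx
    have hy : x.rep 1 ≠ 0 := h1
    have hq' := hq x hx
    rw [e1_mul x hxe, aff_f2 x h1, aff_f3 x h1]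
    have h3 := kap1_pow h2
    simp only [OpenPartialHomeomorph.coe_trans, Function.comp_apply]
    generalize 40 + 21 * (aff x).1 * (aff x).2 = q at *
    field_simp
    linear_combination h3
  · intro _ x hx
    obtain ⟨h1, h2⟩ := (hsrc x).1 hx
    exact (hw _ h2.2).1

theorem pi1_S1 {r : ℕ} (σ : Fin (r+1) → ℂ) (hσ : ∀ i, σ i ≠ 0) (hσ' : ∀ i, σ i ≠ - (1 / 441))
    (hinj : Function.Injective σ) :
    ∀ x : S1 σ, Nonempty (FundamentalGroup (S1 σ) x ≃*
      Monoid.Coprod (FreeGroup (Fin (r + 1))) (Multiplicative (ZMod 3))) := by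
  refine preP_pi1 (S1 σ) (isOpen_S1 σ) (m := 3) (by norm_num) (α := Unit)
    (Fin.cons (1 / 441) (fun i => σ i + 1 / 441)) ?_ ?_ e1 ?_ ?_ ?_ (gO r 3) (gO_closure r 3)
    (gO_zero_pow r 3) (gO_univ r 3)
  · intro i
    refine Fin.cases (by simp) (fun i => ?_) i
    rw [Fin.cons_succ]
    intro h
    exact hσ' i (by linear_combination h)
  · rw [Fin.cons_injective_iff]
    refine ⟨?_, ?_⟩
    · rintro ⟨i, hi⟩
      exact hσ i (by linear_combination hi)
    · intro i j h
      exact hinj (by simpa using h)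
  · exact e1_target
  · intro x hx
    have h3 : f3 x.rep ≠ 0 := hx.2
    rw [e1_mul x hx]
    constructor
    · rintro ⟨-, h⟩ i
      refine Fin.cases (by simp) (fun i _ => ?_) i
      rw [Fin.cons_succ]
      intro h'
      apply h i
      rw [add_left_inj, div_eq_iff (by positivity)] at h'
      exact h'
    · intro h
      refine ⟨h3, fun i h' => h i.succ (Fin.succ_ne_zero i) ?_⟩
      rw [Fin.cons_succ, h']
      field_simp
  · intro ε hε
    exact preP1 σ hσ ε hε

end FGP
end

section
open Set Topology Filter
namespace FGP

/-- principal square root -/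
noncomputable def sq (z : ℂ) : ℂ := z ^ (2⁻¹ : ℂ)

theorem sq_pow (z : ℂ) : sq z ^ 2 = z := by
  have := Complex.cpow_nat_inv_pow z (n := 2) (by norm_num)
  simpa [sq] using this

theorem sq_re_pos (z : ℂ) (hz : z ∈ Complex.slitPlane) : 0 < (sq z).re := by
  have h0 := Complex.slitPlane_ne_zero hz
  rw [sq, Complex.cpow_def_of_ne_zero h0, Complex.exp_re]
  apply mul_pos (Real.exp_pos _)
  have h1 : (Complex.log z * 2⁻¹).im = z.arg / 2 := by
    rw [← div_eq_mul_inv, ← Complex.log_im]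
    simp
  rw [h1]
  have h2 := Complex.neg_pi_lt_arg z
  have h3 := Complex.arg_le_pi z
  have h4 := (Complex.mem_slitPlane_iff_arg.1 hz).1
  have h5 := lt_of_le_of_ne h3 h4
  exact Real.cos_pos_of_mem_Ioo ⟨by linarith, by linarith⟩

theorem sq_sq (h : ℂ) (hh : 0 < h.re) : sq (h ^ 2) = h := Complex.sq_cpow_two_inv hh

theorem sq_mem_slit (h : ℂ) (hh : 0 < h.re) : h ^ 2 ∈ Complex.slitPlane := by
  rw [Complex.mem_slitPlane_iff, pow_two, Complex.mul_re, Complex.mul_im]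
  by_cases hi : h.im = 0
  · left; rw [hi]; nlinarith
  · right
    intro h2
    have : h.re * h.im = 0 := by linarith
    rcases mul_eq_zero.1 this with h3 | h3
    · exact hh.ne' h3
    · exact hi h3

theorem continuousOn_sq : ContinuousOn sq Complex.slitPlane := fun z hz =>
  (continuousAt_id.cpow continuousAt_const hz).continuousWithinAt

/-- Signs. -/
def sg : Bool → ℂ | false => 1 | true => -1
/-- Square roots of signs. -/
noncomputable def kp : Bool → ℂ | false => 1 | true => -Complex.I

theorem sg_sq (b) : sg b * sg b = 1 := by cases b <;> simp [sg]
theorem sg_ne (b) : sg b ≠ 0 := by cases b <;> simp [sg]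
theorem kp_ne (b) : kp b ≠ 0 := by cases b <;> simp [kp]
theorem kp_sq (b) : kp b ^ 2 = sg b := by cases b <;> simp [kp, sg]

/-- Square root of the (signed) second coordinate. -/
noncomputable def hh (b : Bool) (q : ℂ × ℂ) : ℂ := sq (sg b * q.2)

theorem hh_pow (b q) : hh b q ^ 2 = sg b * q.2 := sq_pow _
theorem hh_ne {b q} (h : sg b * q.2 ∈ Complex.slitPlane) : hh b q ≠ 0 := by
  intro h0
  have := sq_re_pos _ h
  rw [show sq (sg b * q.2) = 0 from h0] at this
  simp at this

theorem isOpen_slit (b : Bool) : IsOpen {q : ℂ × ℂ | sg b * q.2 ∈ Complex.slitPlane} :=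
  Complex.isOpen_slitPlane.preimage (f := fun q : ℂ × ℂ => sg b * q.2) (by fun_prop)

theorem continuousOn_hh (b) : ContinuousOn (hh b) {q | sg b * q.2 ∈ Complex.slitPlane} :=
  continuousOn_sq.comp (f := fun q : ℂ × ℂ => sg b * q.2) (by fun_prop) (fun q hq => hq)

/-- Second coordinate of `kap2`. -/
noncomputable def vv (b : Bool) (q : ℂ × ℂ) : ℂ :=
  (40 + 21 * q.1 * q.2) / (21 * kp b * hh b q ^ 3)

theorem continuousOn_vv (b) : ContinuousOn (vv b) {q | sg b * q.2 ∈ Complex.slitPlane} := by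
  have := continuousOn_hh b
  exact ContinuousOn.div (by fun_prop) (by fun_prop) (fun q hq =>
    mul_ne_zero (mul_ne_zero (by norm_num) (kp_ne b)) (pow_ne_zero _ (hh_ne hq)))

/-- Local coordinates for the order 2 case. -/
noncomputable def kap2 (δ : ℝ) (b : Bool) : OpenPartialHomeomorph (ℂ × ℂ) (ℂ × ℂ) where
  toFun q := (hh b q - 1, vv b q)
  invFun q := ((21 * kp b * q.2 * (q.1 + 1) ^ 3 - 40) / (21 * (sg b * (q.1 + 1) ^ 2)),
    sg b * (q.1 + 1) ^ 2)
  source := {q | sg b * q.2 ∈ Complex.slitPlane} ∩ vv b ⁻¹' {w | ‖w‖ < δ}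
  target := {q | -1 < q.1.re ∧ ‖q.2‖ < δ}
  map_source' := by
    rintro q ⟨h1, h2⟩
    refine ⟨?_, h2⟩
    have := sq_re_pos _ h1
    change -1 < (sq (sg b * q.2) - 1).re
    simp only [Complex.sub_re, Complex.one_re]
    linarith
  map_target' := by
    rintro ⟨η, v⟩ ⟨h1, h2⟩
    simp only at h1 h2
    have hp : 0 < (η + 1).re := by simp only [Complex.add_re, Complex.one_re]; linarith
    have hn : η + 1 ≠ 0 := by intro h; rw [h] at hp; simp at hp
    have hs := sg_ne b
    have hk := kp_ne b
    have e1 : sg b * (sg b * (η + 1) ^ 2) = (η + 1) ^ 2 := by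
      rw [← mul_assoc, sg_sq, one_mul]
    refine ⟨?_, ?_⟩
    · simp only [mem_ofPred_eq, e1]
      exact sq_mem_slit _ hp
    · simp only [mem_preimage, vv, hh, e1, sq_sq _ hp]
      change ‖_‖ < δ
      convert h2 using 2
      field_simp
      ring
  left_inv' := by
    rintro ⟨x, u⟩ ⟨h1, h2⟩
    have hn := hh_ne h1
    have hs := sg_ne b
    have hk := kp_ne b
    have hu : u ≠ 0 := by
      rintro rfl
      exact Complex.slitPlane_ne_zero h1 (by simp)
    have hp := hh_pow b (x, u)
    simp only [sub_add_cancel, vv] at hp ⊢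
    have e1 : sg b * hh b (x, u) ^ 2 = u := by
      rw [hp, ← mul_assoc, sg_sq, one_mul]
    rw [e1]
    ext
    · simp only
      field_simp
      ring
    · rfl
  right_inv' := by
    rintro ⟨η, v⟩ ⟨h1, h2⟩
    simp only at h1 h2
    have hp : 0 < (η + 1).re := by simp only [Complex.add_re, Complex.one_re]; linarith
    have hn : η + 1 ≠ 0 := by intro h; rw [h] at hp; simp at hp
    have hs := sg_ne b
    have hk := kp_ne b
    have e1 : sg b * (sg b * (η + 1) ^ 2) = (η + 1) ^ 2 := by
      rw [← mul_assoc, sg_sq, one_mul]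
    simp only [vv, hh, e1, sq_sq _ hp]
    ext
    · simp
    · simp only
      field_simp
      ring
  open_source := by
    apply ContinuousOn.isOpen_inter_preimage (continuousOn_vv b) (isOpen_slit b)
    exact isOpen_lt (by fun_prop) (by fun_prop)
  open_target := by
    apply IsOpen.and
    · exact isOpen_lt (by fun_prop) (Complex.continuous_re.comp continuous_fst)
    · exact isOpen_lt (by fun_prop) (by fun_prop)
  continuousOn_toFun := by
    apply ContinuousOn.mono _ inter_subset_left
    exact ((continuousOn_hh b).sub continuousOn_const).prodMk (continuousOn_vv b)
  continuousOn_invFun := by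
    refine ContinuousOn.prodMk (ContinuousOn.div (by fun_prop) (by fun_prop) ?_) (by fun_prop)
    rintro ⟨η, v⟩ ⟨h1, h2⟩
    simp only at h1 h2
    have hp : 0 < (η + 1).re := by simp only [Complex.add_re, Complex.one_re]; linarith
    have hn : η + 1 ≠ 0 := by intro h; rw [h] at hp; simp at hp
    exact mul_ne_zero (by norm_num) (mul_ne_zero (sg_ne b) (pow_ne_zero _ hn))

theorem kap2_source {δ b q} : q ∈ (kap2 δ b).source ↔
  sg b * q.2 ∈ Complex.slitPlane ∧ ‖vv b q‖ < δ := Iff.rfl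
theorem kap2_target {δ b} : (kap2 δ b).target = {q | -1 < q.1.re ∧ ‖q.2‖ < δ} := rfl
theorem kap2_two {δ b q} : ((kap2 δ b) q).2 = vv b q := rfl

theorem vv_pow {b q} (h : sg b * q.2 ∈ Complex.slitPlane) :
    (40 + 21 * q.1 * q.2) ^ 2 = 441 * vv b q ^ 2 * q.2 ^ 3 := by
  have hn := hh_ne h
  have hk := kp_ne b
  have h6 : hh b q ^ 6 = sg b * q.2 ^ 3 := by
    calc hh b q ^ 6 = (hh b q ^ 2) ^ 3 := by ring
      _ = (sg b * sg b) * sg b * q.2 ^ 3 := by rw [hh_pow]; ring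
      _ = _ := by rw [sg_sq]; ring
  have h1 : vv b q * (21 * kp b * hh b q ^ 3) = 40 + 21 * q.1 * q.2 := by
    rw [vv, div_mul_cancel₀]
    exact mul_ne_zero (mul_ne_zero (by norm_num) hk) (pow_ne_zero _ hn)
  rw [← h1]
  calc (vv b q * (21 * kp b * hh b q ^ 3)) ^ 2 = 441 * vv b q ^ 2 * (kp b ^ 2 * hh b q ^ 6) := by ring
    _ = 441 * vv b q ^ 2 * ((sg b * sg b) * q.2 ^ 3) := by rw [h6, kp_sq]; ring
    _ = _ := by rw [sg_sq, one_mul]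

theorem vv_overlap (q : ℂ × ℂ) (h1 : q.2.im ≠ 0) :
    vv true q = (if 0 < q.2.im then 1 else -1) * vv false q := by
  have hf : sg false * q.2 ∈ Complex.slitPlane := by right; simpa [sg] using h1
  have ht : sg true * q.2 ∈ Complex.slitPlane := by right; simpa [sg] using h1
  have pf : 0 < (hh false q).re := sq_re_pos _ hf
  have pt : 0 < (hh true q).re := sq_re_pos _ ht
  have ef := hh_pow false q
  have et := hh_pow true q
  simp only [sg, one_mul] at ef et
  have hI := Complex.I_sq
  have him : q.2.im = 2 * (hh false q).re * (hh false q).im := by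
    rw [← ef, pow_two, Complex.mul_im]; ring
  have hn := hh_ne hf
  have : (hh true q - Complex.I * hh false q) * (hh true q + Complex.I * hh false q) = 0 := by
    linear_combination et + ef - hh false q ^ 2 * hI
  rcases mul_eq_zero.1 this with h | h
  · have h' : hh true q = Complex.I * hh false q := by linear_combination h
    have h2 : (hh false q).im < 0 := by
      rw [h'] at pt; simpa using pt
    have : ¬ 0 < q.2.im := by rw [him]; nlinarith
    rw [if_neg this, vv, vv, h', kp, kp]
    have : 21 * -Complex.I * (Complex.I * hh false q) ^ 3 = - (21 * 1 * hh false q ^ 3) := by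
      linear_combination (-21 * hh false q ^ 3 * Complex.I ^ 2 + 21 * hh false q ^ 3) * hI
    rw [this, div_neg]; ring
  · have h' : hh true q = -Complex.I * hh false q := by linear_combination h
    have h2 : 0 < (hh false q).im := by
      rw [h'] at pt; simpa using pt
    have : 0 < q.2.im := by rw [him]; positivity
    rw [if_pos this, vv, vv, h', kp, kp]
    have : 21 * -Complex.I * (-Complex.I * hh false q) ^ 3 = (21 * 1 * hh false q ^ 3) := by
      linear_combination (21 * hh false q ^ 3 * Complex.I ^ 2 - 21 * hh false q ^ 3) * hI
    rw [this]; ring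

theorem kap2_conn {δ : ℝ} {b} (hδ : 0 < δ) : IsPathConnected ((kap2 δ b).target ∩ {q | q.2 ≠ 0}) := by
  have h1 : IsPathConnected {z : ℂ | -1 < z.re} := 
    (convex_halfSpace_re_gt _).isPathConnected ⟨0, by simp⟩
  have h2 := h1.prod (isPathConnected_punctured δ hδ)
  convert h2 using 1
  ext ⟨x, w⟩
  simp only [kap2_target, mem_inter_iff, mem_ofPred_eq, mem_prod]
  tauto

theorem exists_delta2 {r : ℕ} (σ : Fin r → ℂ) (ε : ℝ) (hε : 0 < ε) :
    ∃ δ > 0, ∀ w : ℂ, ‖w‖ < δ → ‖w ^ 2‖ < ε ∧ ∀ i, 441 * w ^ 2 * σ i ≠ 1 := by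
  have h1 : ∀ᶠ w : ℂ in 𝓝 0, ‖w ^ 2‖ < ε := by
    apply ContinuousAt.eventually_lt (f := fun w : ℂ => ‖w ^ 2‖) (g := fun _ => ε) (by fun_prop)
      (by fun_prop)
    simpa using hε
  have h2 : ∀ᶠ w : ℂ in 𝓝 0, ∀ i, 441 * w ^ 2 * σ i ≠ 1 := by
    rw [eventually_all]
    intro i
    apply ContinuousAt.eventually_ne (by fun_prop)
    simp
  obtain ⟨δ, hδ, h⟩ := Metric.eventually_nhds_iff.1 (h1.and h2)
  exact ⟨δ, hδ, fun w hw => h (by simpa using hw)⟩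

/-- Root of unity correction. -/
noncomputable def EE (b : Bool) (x : P2) : ℂ :=
  bif b then (if 0 < (aff x).2.im then 1 else -1) else 1

theorem EE_sq (b x) : EE b x ^ 2 = 1 := by
  cases b
  · simp [EE]
  · simp only [EE, cond_true]; split_ifs <;> simp

theorem overlap_im (u : ℂ) (h1 : sg false * u ∈ Complex.slitPlane)
    (h2 : sg true * u ∈ Complex.slitPlane) : u.im ≠ 0 := by
  intro h
  simp only [sg, one_mul, neg_mul, Complex.mem_slitPlane_iff, Complex.neg_re, Complex.neg_im, h,
    neg_zero, ne_eq, not_true_eq_false, or_false] at h1 h2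
  linarith

theorem EE_overlap (x : P2) (hx : x ∈ aff.source) (h : (aff x).2.im ≠ 0) :
    ∃ ζ : ℂ, ζ ^ 2 = 1 ∧ ∀ᶠ x' in 𝓝 x, vv true (aff x') = ζ * vv false (aff x') ∧
      EE true x' = ζ * EE false x' := by
  have hc : ContinuousAt (fun x' => (aff x').2.im) x :=
    Complex.continuous_im.continuousAt.comp
      (ContinuousAt.comp continuous_snd.continuousAt (aff.continuousAt hx))
  rcases lt_or_gt_of_ne h with h | h
  · refine ⟨-1, by norm_num, ?_⟩
    filter_upwards [hc.eventually_lt continuousAt_const h] with x' hx'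
    have h3 : ¬ 0 < (aff x').2.im := not_lt.2 (le_of_lt hx')
    refine ⟨?_, ?_⟩
    · rw [vv_overlap _ (ne_of_lt hx'), if_neg h3]
    · simp [EE, h3]
  · refine ⟨1, by norm_num, ?_⟩
    filter_upwards [continuousAt_const.eventually_lt hc h] with x' hx'
    refine ⟨?_, ?_⟩
    · rw [vv_overlap _ (ne_of_gt hx'), if_pos hx']
    · simp [EE, hx']

theorem preP2 {r : ℕ} (σ : Fin r → ℂ) (ε : ℝ) (hε : 0 < ε) :
    Nonempty (PreP P2 (S2 σ) 2 Bool 441 e2 ε) := by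
  obtain ⟨δ, hδ, hw⟩ := exists_delta2 σ ε hε
  have hsrc : ∀ b x, x ∈ (aff.trans (kap2 δ b)).source ↔
      x ∈ aff.source ∧ aff x ∈ (kap2 δ b).source := fun b x => by simp
  have htgt : ∀ b, (aff.trans (kap2 δ b)).target = (kap2 δ b).target := by
    intro b; simp [aff_target]
  have hu : ∀ b x, x ∈ (aff.trans (kap2 δ b)).source → (aff x).2 ≠ 0 := by
    intro b x hx h
    have := Complex.slitPlane_ne_zero ((hsrc b x).1 hx).2.1
    rw [h] at this
    simp at this
  refine ⟨{
    k := fun b => aff.trans (kap2 δ b)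
    hkS := ?_
    hcov := ?_
    hstar := ?_
    h0 := ?_
    hconn := ?_
    hke := ?_
    hkd := ?_
    hkε := ?_
    E := EE
    hE1 := EE_sq
    hE := ?_
    a0 := true }⟩
  · intro b x hx
    obtain ⟨h1, h2⟩ := (hsrc b x).1 hx
    have hy : x.rep 1 ≠ 0 := h1
    have hu' := hu b x hx
    refine ⟨?_, ?_⟩
    · rw [aff_f2 x h1]
      exact mul_ne_zero (pow_ne_zero _ hy) hu'
    · intro i h
      rw [aff_f3 x h1, aff_f2 x h1, mul_pow _ (_ + _), vv_pow h2.1] at h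
      refine (hw _ h2.2).2 i ?_
      apply mul_right_cancel₀ (pow_ne_zero 3 hu')
      have : x.rep 1 ^ 6 ≠ 0 := by positivity
      apply mul_left_cancel₀ this
      linear_combination -h
  · intro x hx hxe
    have h2 := hx.1
    have h3 : f3 x.rep = 0 := by
      by_contra h
      exact hxe ⟨h2, h⟩
    have hy : x.rep 1 ≠ 0 := by
      intro h
      have h4 : x.rep 0 = 0 := by
        rw [f3, h] at h3
        simpa [h2] using h3
      apply h2
      rw [f2, h, h4]; ring
    have hu' : (aff x).2 ≠ 0 := by
      rw [aff_apply]
      exact div_ne_zero h2 (pow_ne_zero _ hy)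
    have hq : 40 + 21 * (aff x).1 * (aff x).2 = 0 := by
      have := aff_f3 x hy
      rw [h3] at this
      rcases mul_eq_zero.1 this.symm with h | h
      · exact absurd h (pow_ne_zero _ hy)
      · exact h
    have hb : ∃ b, sg b * (aff x).2 ∈ Complex.slitPlane := by
      by_cases h : (aff x).2 ∈ Complex.slitPlane
      · exact ⟨false, by simpa [sg] using h⟩
      · refine ⟨true, ?_⟩
        rw [Complex.mem_slitPlane_iff] at h ⊢
        push Not at h
        left
        have : (aff x).2.re ≠ 0 := fun h' => hu' (Complex.ext h' h.2)
        simp only [sg, neg_mul, one_mul, Complex.neg_re]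
        have := lt_of_le_of_ne h.1 this
        linarith
    obtain ⟨b, hb⟩ := hb
    refine ⟨b, (hsrc b x).2 ⟨hy, hb, ?_⟩⟩
    simp [vv, hq, hδ]
  · intro b
    rw [htgt, kap2_target, starConvex_zero_iff]
    rintro ⟨x, w⟩ ⟨h1, h2⟩ a ha0 ha1
    simp only at h1 h2
    refine ⟨?_, ?_⟩
    · simp only [Prod.smul_mk, Complex.real_smul, Complex.re_ofReal_mul]
      have h3 : 0 ≤ a * (x.re + 1) := mul_nonneg ha0 (by linarith)
      rcases lt_or_eq_of_le ha1 with h | rfl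
      · linarith
      · linarith
    · simp only [Prod.smul_mk]
      rw [norm_smul, Real.norm_of_nonneg ha0]
      nlinarith [norm_nonneg w]
  · intro b
    rw [htgt, kap2_target]
    simp [hδ]
  · intro b
    rw [htgt]
    exact kap2_conn hδ
  · intro b x hx
    obtain ⟨h1, h2⟩ := (hsrc b x).1 hx
    have hy : x.rep 1 ≠ 0 := h1
    have hu' := hu b x hx
    have hn := hh_ne h2.1
    have hk := kp_ne b
    rw [e2_source, aff_f2 x h1, aff_f3 x h1]
    simp only [OpenPartialHomeomorph.coe_trans, Function.comp_apply, kap2_two, vv]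
    simp [hy, hu', hn, hk]
  · intro b x hx hxe
    obtain ⟨h1, h2⟩ := (hsrc b x).1 hx
    have hy : x.rep 1 ≠ 0 := h1
    have hu' := hu b x hx
    rw [e2_mul x hxe, aff_f2 x h1, aff_f3 x h1, mul_pow _ (_ + _), vv_pow h2.1]
    simp only [OpenPartialHomeomorph.coe_trans, Function.comp_apply, kap2_two]
    field_simp
    ring
  · intro b x hx
    obtain ⟨h1, h2⟩ := (hsrc b x).1 hx
    exact (hw _ h2.2).1
  · intro a b x ha hb
    obtain ⟨h1, h2⟩ := (hsrc a x).1 ha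
    obtain ⟨h1', h2'⟩ := (hsrc b x).1 hb
    simp only [OpenPartialHomeomorph.coe_trans, Function.comp_apply, kap2_two]
    cases a <;> cases b
    · exact ⟨1, by simp, by simp⟩
    · obtain ⟨ζ, hζ, h⟩ := EE_overlap x h1 (overlap_im _ h2.1 h2'.1)
      refine ⟨ζ, hζ, ?_⟩
      filter_upwards [h] with x' hx'
      rw [hx'.1, hx'.2, ← mul_assoc, ← mul_assoc, ← pow_two, hζ]
      simp
    · exact EE_overlap x h1 (overlap_im _ h2'.1 h2.1)
    · exact ⟨1, by simp, by simp⟩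

theorem pi1_S2 {r : ℕ} (σ : Fin (r+1) → ℂ) (hσ : ∀ i, σ i ≠ 0) (hσ' : ∀ i, σ i ≠ - (1 / 441))
    (hinj : Function.Injective σ) :
    ∀ x : S2 σ, Nonempty (FundamentalGroup (S2 σ) x ≃*
      Monoid.Coprod (FreeGroup (Fin (r + 1))) (Multiplicative (ZMod 2))) := by
  refine preP_pi1 (S2 σ) (isOpen_S2 σ) (m := 2) (by norm_num) (α := Bool)
    (Fin.cons 441 (fun i => 1 / σ i + 441)) ?_ ?_ e2 ?_ ?_ ?_ (gO r 2) (gO_closure r 2)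
    (gO_zero_pow r 2) (gO_univ r 2)
  · intro i
    refine Fin.cases (by simp) (fun i => ?_) i
    rw [Fin.cons_succ]
    intro h
    have h0 := hσ i
    field_simp at h
    exact hσ' i (by linear_combination h / 441)
  · rw [Fin.cons_injective_iff]
    refine ⟨?_, ?_⟩
    · rintro ⟨i, hi⟩
      exact one_div_ne_zero (hσ i) (by linear_combination hi)
    · intro i j h
      exact hinj (by simpa using h)
  · exact e2_target
  · intro x hx
    have h2 : f2 x.rep ≠ 0 := hx.1
    have h3 : f3 x.rep ≠ 0 := hx.2
    rw [e2_mul x hx]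
    constructor
    · rintro ⟨-, h⟩ i
      refine Fin.cases (by simp) (fun i _ => ?_) i
      rw [Fin.cons_succ]
      intro h'
      apply h i
      rw [add_left_inj, div_eq_div_iff (by positivity) (hσ i)] at h'
      linear_combination -h'
    · intro h
      refine ⟨h2, fun i h' => h i.succ (Fin.succ_ne_zero i) ?_⟩
      have h0 := hσ i
      rw [Fin.cons_succ, h']
      field_simp
  · intro ε hε
    exact preP2 σ ε hε

end FGP
end

section
open Set Topology Filter
namespace FGP

theorem pt_eq (a b a' b' : ℂ) (h h') (hd : a * b' = a' * b) : pt a b h = pt a' b' h' := by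
  rw [pt, pt, Projectivization.mk_eq_mk_iff']
  by_cases ha : a' = 0
  · have hb' : b' ≠ 0 := by
      rintro rfl; exact h' (by ext i; fin_cases i <;> simp [ha])
    subst ha
    have ha : a = 0 := by simpa [hb'] using hd
    refine ⟨b / b', ?_⟩
    ext i; fin_cases i <;> simp [ha, hb']
  · refine ⟨a / a', ?_⟩
    ext i; fin_cases i
    · simp [ha]
    · simp; field_simp; exact hd

end FGP
end

/-- For `f₂ = yz − x²` and `f₃ = 40y³ + 21xyz − 21x³`, consider the pencil
`F = [f₂³ : f₃²]`. There is a finite set `A ⊆ ℙ¹` containing `[0:1]` and `[1:0]` such that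
for any union `C_B` of `r+1` distinct fibers over points outside `A`, one has
`π₁(ℙ² \ (C_B ∪ V(f₃))) ≅ 𝔽_{r+1} * ℤ₃` and `π₁(ℙ² \ (C_B ∪ V(f₂))) ≅ 𝔽_{r+1} * ℤ₂`. -/
theorem stmt_14 (f₂ f₃ : MvPolynomial (Fin 3) ℂ)
    (hf₂ : f₂ = X 1 * X 2 - X 0 ^ 2)
    (hf₃ : f₃ = C 40 * X 1 ^ 3 + C 21 * (X 0 * X 1 * X 2) - C 21 * X 0 ^ 3) :
    ∃ A : Set P1, A.Finite ∧
      pt 0 1 (by intro h; exact (one_ne_zero : (1:ℂ) ≠ 0) (by simpa using congrFun h 1)) ∈ A ∧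
      pt 1 0 (by intro h; exact (one_ne_zero : (1:ℂ) ≠ 0) (by simpa using congrFun h 0)) ∈ A ∧
      ∀ (r : ℕ) (a b : Fin (r + 1) → ℂ) (hab : ∀ i, ![a i, b i] ≠ 0),
        (∀ i, pt (a i) (b i) (hab i) ∉ A) →
        Function.Injective (fun i => pt (a i) (b i) (hab i)) →
        (∀ x : ↥((⋃ i, V (C (b i) * f₂ ^ 3 - C (a i) * f₃ ^ 2)) ∪ V f₃)ᶜ,
          Nonempty
            (FundamentalGroup (↥((⋃ i, V (C (b i) * f₂ ^ 3 - C (a i) * f₃ ^ 2)) ∪ V f₃)ᶜ) x ≃*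
              Monoid.Coprod (FreeGroup (Fin (r + 1))) (Multiplicative (ZMod 3)))) ∧
        (∀ x : ↥((⋃ i, V (C (b i) * f₂ ^ 3 - C (a i) * f₃ ^ 2)) ∪ V f₂)ᶜ,
          Nonempty
            (FundamentalGroup (↥((⋃ i, V (C (b i) * f₂ ^ 3 - C (a i) * f₃ ^ 2)) ∪ V f₂)ᶜ) x ≃*
              Monoid.Coprod (FreeGroup (Fin (r + 1))) (Multiplicative (ZMod 2)))) := by
  have h01 : ![(0 : ℂ), 1] ≠ 0 := by
    intro h; exact (one_ne_zero : (1:ℂ) ≠ 0) (by simpa using congrFun h 1)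
  have h10 : ![(1 : ℂ), 0] ≠ 0 := by
    intro h; exact (one_ne_zero : (1:ℂ) ≠ 0) (by simpa using congrFun h 0)
  have h44 : ![(-1 : ℂ), 441] ≠ 0 := by
    intro h
    have := congrFun h 0
    simp at this
  have e2 : ∀ v, eval v f₂ = FGP.f2 v := by
    intro v; rw [hf₂]; simp [FGP.f2]
  have e3 : ∀ v, eval v f₃ = FGP.f3 v := by
    intro v; rw [hf₃]; simp [FGP.f3, FGP.f2]; ring
  refine ⟨{pt 0 1 h01, pt 1 0 h10, pt (-1) 441 h44}, Set.toFinite _, by simp, by simp, ?_⟩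
  intro r a b hab hA hinj
  have ha : ∀ i, a i ≠ 0 := by
    intro i h
    apply hA i
    rw [FGP.pt_eq (a i) (b i) 0 1 (hab i) h01 (by rw [h]; ring)]
    simp
  have hb : ∀ i, b i ≠ 0 := by
    intro i h
    apply hA i
    rw [FGP.pt_eq (a i) (b i) 1 0 (hab i) h10 (by rw [h]; ring)]
    simp
  have hc : ∀ i, a i / b i ≠ -(1 / 441) := by
    intro i h
    apply hA i
    rw [FGP.pt_eq (a i) (b i) (-1) 441 (hab i) h44 (by
      have := hb i
      rw [div_eq_iff this] at h
      rw [h]; ring)]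
    simp
  have hi : Function.Injective (fun i => a i / b i) := by
    intro i j h
    apply hinj
    apply FGP.pt_eq
    exact (div_eq_div_iff (hb i) (hb j)).1 h
  have key : ∀ p : P2, (∀ i, p ∉ V (C (b i) * f₂ ^ 3 - C (a i) * f₃ ^ 2)) ↔
      ∀ i, FGP.f2 p.rep ^ 3 ≠ a i / b i * FGP.f3 p.rep ^ 2 := by
    intro p
    apply forall_congr'
    intro i
    apply not_congr
    have := hb i
    simp only [V, Set.mem_ofPred_eq, map_sub, map_mul, map_pow, eval_C, e2, e3]
    constructor
    · intro h
      field_simp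
      linear_combination h
    · intro h
      rw [h]
      field_simp
      ring
  have s1 : ((⋃ i, V (C (b i) * f₂ ^ 3 - C (a i) * f₃ ^ 2)) ∪ V f₃)ᶜ =
      FGP.S1 (fun i => a i / b i) := by
    ext p
    have := key p
    simp only [Set.mem_compl_iff, Set.mem_union, Set.mem_iUnion, not_or, not_exists, this, FGP.S1,
      Set.mem_ofPred_eq]
    rw [and_comm]
    simp only [V, Set.mem_ofPred_eq, e3]
  have s2 : ((⋃ i, V (C (b i) * f₂ ^ 3 - C (a i) * f₃ ^ 2)) ∪ V f₂)ᶜ =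
      FGP.S2 (fun i => a i / b i) := by
    ext p
    have := key p
    simp only [Set.mem_compl_iff, Set.mem_union, Set.mem_iUnion, not_or, not_exists, this, FGP.S2,
      Set.mem_ofPred_eq]
    rw [and_comm]
    simp only [V, Set.mem_ofPred_eq, e2]
  rw [s1, s2]
  have h0 : ∀ i, a i / b i ≠ 0 := fun i => div_ne_zero (ha i) (hb i)
  exact ⟨FGP.pi1_S1 _ h0 hc hi, FGP.pi1_S2 _ h0 hc hi⟩
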